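/- Let σ = 1 and μ = 0, and let (u, ρ) be a classical solution of the R2CH system on [0,T) such that ‖ρ(t,·)‖_{L^∞} ≤ M̄ for all t ∈ [0,T). Then the function t ↦ ∫_ℝ (∂_x u(t,x))³ dx is differentiable on [0,T) and satisfies d/dt ∫_ℝ (∂_x u(t,x))³ dx ≤ −(1/2)∫_ℝ (∂_x u(t,x))⁴ dx + N for all t ∈ [0,T), where N = N(M̄) is the constant defined in the context. (Key differential inequality in the proof of Theorem 4.2) -/

import Mathlib

open Set Filter MeasureTheory Topology Real

/-- A classical solution of the rotation-two-component Camassa–Holm (R2CH) system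
on `[0,T) × ℝ`:  `u` has continuous spatial derivatives up to order three and a
continuous time derivative (also of `∂ₓ²u`), `ρ` has a continuous spatial
derivative and a continuous time derivative, both equations hold pointwise,
`u(t,·), ∂ₓu(t,·), ∂ₓ²u(t,·), ρ(t,·)-1, ∂ₓρ(t,·)` are square integrable,
`ρ(t,·)-1` is bounded and `u → 0`, `∂ₓu → 0`, `ρ → 1` as `|x| → ∞`. -/
structure R2CHSolution (A μ σ Ω T : ℝ) (u ρ : ℝ → ℝ → ℝ) : Prop where
  T_pos : 0 < T
  u_smooth : ∀ t ∈ Ico (0:ℝ) T, ContDiff ℝ 3 (u t)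
  ρ_smooth : ∀ t ∈ Ico (0:ℝ) T, ContDiff ℝ 1 (ρ t)
  u_jcont : ∀ k : ℕ, k ≤ 3 →
    ContinuousOn (fun p : ℝ × ℝ => iteratedDeriv k (u p.1) p.2) (Ico 0 T ×ˢ (univ : Set ℝ))
  ρ_jcont : ∀ k : ℕ, k ≤ 1 →
    ContinuousOn (fun p : ℝ × ℝ => iteratedDeriv k (ρ p.1) p.2) (Ico 0 T ×ˢ (univ : Set ℝ))
  u_tdiff : ∀ x : ℝ, ∀ t ∈ Ico (0:ℝ) T,
    DifferentiableWithinAt ℝ (fun s => u s x) (Ico 0 T) t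
  uxx_tdiff : ∀ x : ℝ, ∀ t ∈ Ico (0:ℝ) T,
    DifferentiableWithinAt ℝ (fun s => deriv (deriv (u s)) x) (Ico 0 T) t
  ρ_tdiff : ∀ x : ℝ, ∀ t ∈ Ico (0:ℝ) T,
    DifferentiableWithinAt ℝ (fun s => ρ s x) (Ico 0 T) t
  ut_jcont : ContinuousOn
    (fun p : ℝ × ℝ => derivWithin (fun s => u s p.2) (Ico 0 T) p.1) (Ico 0 T ×ˢ (univ : Set ℝ))
  utxx_jcont : ContinuousOn
    (fun p : ℝ × ℝ => derivWithin (fun s => deriv (deriv (u s)) p.2) (Ico 0 T) p.1)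
    (Ico 0 T ×ˢ (univ : Set ℝ))
  ρt_jcont : ContinuousOn
    (fun p : ℝ × ℝ => derivWithin (fun s => ρ s p.2) (Ico 0 T) p.1) (Ico 0 T ×ˢ (univ : Set ℝ))
  eq_u : ∀ t ∈ Ico (0:ℝ) T, ∀ x : ℝ,
    derivWithin (fun s => u s x) (Ico 0 T) t
      - derivWithin (fun s => deriv (deriv (u s)) x) (Ico 0 T) t
      - A * deriv (u t) x + 3 * u t x * deriv (u t) x
    = σ * (2 * deriv (u t) x * deriv (deriv (u t)) x
            + u t x * deriv (deriv (deriv (u t))) x)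
      - μ * deriv (deriv (deriv (u t))) x
      - (1 - 2 * Ω * A) * ρ t x * deriv (ρ t) x
      + 2 * Ω * ρ t x * deriv (fun y => ρ t y * u t y) x
  eq_ρ : ∀ t ∈ Ico (0:ℝ) T, ∀ x : ℝ,
    derivWithin (fun s => ρ s x) (Ico 0 T) t + deriv (fun y => u t y * ρ t y) x = 0
  u_L2 : ∀ t ∈ Ico (0:ℝ) T, Integrable (fun x => (u t x) ^ 2)
  ux_L2 : ∀ t ∈ Ico (0:ℝ) T, Integrable (fun x => (deriv (u t) x) ^ 2)
  uxx_L2 : ∀ t ∈ Ico (0:ℝ) T, Integrable (fun x => (deriv (deriv (u t)) x) ^ 2)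
  ρm1_L2 : ∀ t ∈ Ico (0:ℝ) T, Integrable (fun x => (ρ t x - 1) ^ 2)
  ρx_L2 : ∀ t ∈ Ico (0:ℝ) T, Integrable (fun x => (deriv (ρ t) x) ^ 2)
  ρm1_Linf : ∀ t ∈ Ico (0:ℝ) T, ∃ B : ℝ, ∀ x : ℝ, |ρ t x - 1| ≤ B
  u_decay : ∀ t ∈ Ico (0:ℝ) T, Tendsto (u t) (cocompact ℝ) (𝓝 0)
  ux_decay : ∀ t ∈ Ico (0:ℝ) T, Tendsto (deriv (u t)) (cocompact ℝ) (𝓝 0)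
  ρ_decay : ∀ t ∈ Ico (0:ℝ) T, Tendsto (ρ t) (cocompact ℝ) (𝓝 1)

/-- The energy `E(t) = ∫ (u² + uₓ² + (1-2ΩA)(ρ-1)²) dx`. -/
noncomputable def energy (Ω A : ℝ) (u ρ : ℝ → ℝ → ℝ) (t : ℝ) : ℝ :=
  ∫ x : ℝ, ((u t x) ^ 2 + (deriv (u t) x) ^ 2 + (1 - 2 * Ω * A) * (ρ t x - 1) ^ 2)

/-- The constant `N(M̄)` from Theorem 4.2, with `E = E(0)`. -/
noncomputable def Nconst (A Ω M E : ℝ) : ℝ :=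
  (3 * M ^ 2 * (1 - 2 * Ω * A) / 2 + 9 / 4) * E
    + (3 * Real.sqrt 2 * Ω * M ^ 2 / 2) * (E * Real.sqrt E)
    + (3 * Real.sqrt 2 * Ω / (4 * (1 - 2 * Ω * A))) * (E ^ 2 * Real.sqrt E)
    + ((6 + 3 * A ^ 2 + 6 * Ω ^ 2) / 4
        + 3 * Real.sqrt 2 * Ω / (2 * Real.sqrt (1 - 2 * Ω * A))
        + 3 * Ω * (1 - Ω * A) * (M + 1) / (2 * (1 - 2 * Ω * A))) * E ^ 2

theorem exists_bound_Icc_of_eventually_le {E : ℝ → ℝ} {a b : ℝ}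
    (h : ∀ t ∈ Icc a b, ∃ K, ∀ᶠ s in 𝓝 t, E s ≤ K) : ∃ K, ∀ t ∈ Icc a b, E t ≤ K := by
  refine isCompact_Icc.induction_on (p := fun A => ∃ K, ∀ t ∈ A, E t ≤ K) ⟨0, by simp⟩ ?_ ?_ ?_
  · rintro s t hst ⟨K, hK⟩
    exact ⟨K, fun x hx => hK x (hst hx)⟩
  · rintro s t ⟨K, hK⟩ ⟨L, hL⟩
    refine ⟨max K L, fun x hx => ?_⟩
    rcases hx with hx | hx
    · exact (hK x hx).trans (le_max_left _ _)
    · exact (hL x hx).trans (le_max_right _ _)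
  · intro t ht
    obtain ⟨K, hK⟩ := h t ht
    exact ⟨_, mem_nhdsWithin_of_mem_nhds hK, K, fun x hx => hx⟩

/-- A function with closed sublevel sets that takes equal values at the endpoints of every
interval on which it is bounded above is constant. -/
theorem eq_of_isClosed_sublevel {E : ℝ → ℝ} (hcl : ∀ K : ℝ, IsClosed {t | E t ≤ K})
    (hE : ∀ a b K, a ≤ b → (∀ t ∈ Icc a b, E t ≤ K) → E a = E b) (s t : ℝ) : E s = E t := by
  set G : Set ℝ := {t | ∃ K, ∀ᶠ s in 𝓝 t, E s ≤ K} with hG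
  have hGo : IsOpen G := by
    rw [isOpen_iff_mem_nhds]
    rintro x ⟨K, hK⟩
    filter_upwards [eventually_eventually_nhds.2 hK] with y hy using ⟨K, hy⟩
  have hcompact : ∀ a b, a ≤ b → Icc a b ⊆ G → E a = E b := by
    intro a b hab hsub
    obtain ⟨K, hK⟩ := exists_bound_Icc_of_eventually_le (fun x hx => hsub hx)
    exact hE a b K hab hK
  have hIco : ∀ a b, a ≤ b → Ico a b ⊆ G → E a = E b := by
    intro a b hab hsub
    refine hE a b (max (E a) (E b)) hab fun x hx => ?_
    rcases hx.2.eq_or_lt with rfl | hxb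
    · exact le_max_right _ _
    · rw [← hcompact a x hx.1 fun y hy => hsub ⟨hy.1, hy.2.trans_lt hxb⟩]
      exact le_max_left _ _
  have hIoc : ∀ a b, a ≤ b → Ioc a b ⊆ G → E a = E b := by
    intro a b hab hsub
    refine hE a b (max (E a) (E b)) hab fun x hx => ?_
    rcases hx.1.eq_or_lt with rfl | hxb
    · exact le_max_left _ _
    · rw [hcompact x b hx.2 fun y hy => hsub ⟨hxb.trans_le hy.1, hy.2⟩]
      exact le_max_right _ _
  have hGuniv : G = univ := by
    by_contra hne
    have hBne : (Gᶜ).Nonempty := by rwa [nonempty_compl]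
    have hBc : IsClosed Gᶜ := hGo.isClosed_compl
    have : Nonempty (Gᶜ : Set ℝ) := hBne.to_subtype
    have : BaireSpace (Gᶜ : Set ℝ) := hBc.isGδ.baireSpace_of_t2Space_locallyCompactSpace
    obtain ⟨n, ⟨⟨t0, ht0⟩, ht0n⟩⟩ := nonempty_interior_of_iUnion_of_closed
      (f := fun n : ℕ => {x : (Gᶜ : Set ℝ) | E x ≤ n})
      (fun n => (hcl n).preimage continuous_subtype_val)
      (by
        ext x
        simp only [mem_iUnion, mem_ofPred_eq, mem_univ, iff_true]
        exact exists_nat_ge (E x))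
    rw [mem_interior_iff_mem_nhds, mem_nhds_subtype] at ht0n
    obtain ⟨U, hU, hUn⟩ := ht0n
    obtain ⟨ε, hε, hball⟩ := Metric.mem_nhds_iff.1 hU
    have hbd : ∀ s, s ∉ G → |s - t0| < ε → E s ≤ n := fun s hs hsε =>
      hUn (a := ⟨s, hs⟩) (hball (by simpa [Real.dist_eq] using hsε))
    refine ht0 ⟨n, ?_⟩
    filter_upwards [Metric.ball_mem_nhds t0 hε] with x hx
    rw [Metric.mem_ball, Real.dist_eq, abs_lt] at hx
    by_cases hxG : x ∈ G
    swap
    · exact hbd x hxG (abs_lt.2 hx)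
    rcases le_total x t0 with hxt | hxt
    · have hne : (Gᶜ ∩ Icc x t0).Nonempty := ⟨t0, ht0, hxt, le_rfl⟩
      have hcp : IsCompact (Gᶜ ∩ Icc x t0) := isCompact_Icc.inter_left hBc
      obtain ⟨y, hy⟩ := hcp.exists_isLeast hne
      rw [hIco x y hy.1.2.1 fun z hz => by
        by_contra hzG
        exact absurd (hy.2 ⟨hzG, hz.1, hz.2.le.trans hy.1.2.2⟩) (not_le.2 hz.2)]
      exact hbd y hy.1.1 (abs_lt.2 ⟨by linarith [hy.1.2.1], by linarith [hy.1.2.2]⟩)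
    · have hne : (Gᶜ ∩ Icc t0 x).Nonempty := ⟨t0, ht0, le_rfl, hxt⟩
      have hcp : IsCompact (Gᶜ ∩ Icc t0 x) := isCompact_Icc.inter_left hBc
      obtain ⟨y, hy⟩ := hcp.exists_isGreatest hne
      rw [← hIoc y x hy.1.2.2 fun z hz => by
        by_contra hzG
        exact absurd (hy.2 ⟨hzG, hy.1.2.1.trans hz.1.le, hz.2⟩) (not_le.2 hz.1)]
      exact hbd y hy.1.1 (abs_lt.2 ⟨by linarith [hy.1.2.1], by linarith [hy.1.2.2]⟩)
  rcases le_total s t with h | h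
  · exact hcompact s t h (hGuniv ▸ subset_univ _)
  · exact (hcompact t s h (hGuniv ▸ subset_univ _)).symm

theorem eqOn_Ico_of_isClosed_sublevel {E : ℝ → ℝ} {T : ℝ}
    (hcl : ∀ b < T, ∀ K : ℝ, IsClosed {t | t ∈ Icc 0 b ∧ E t ≤ K})
    (hE : ∀ a b K, 0 ≤ a → a ≤ b → b < T → (∀ t ∈ Icc a b, E t ≤ K) → E a = E b)
    {t : ℝ} (ht : t ∈ Ico 0 T) : E t = E 0 := by
  set cl : ℝ → ℝ := fun s => max 0 (min t s) with hcl_def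
  have hclc : Continuous cl := by fun_prop
  have hmem : ∀ s, cl s ∈ Icc 0 t := fun s =>
    ⟨le_max_left _ _, max_le ht.1 (min_le_left _ _)⟩
  have hid : ∀ s ∈ Icc 0 t, cl s = s := fun s hs => by
    simp only [hcl_def, min_eq_right hs.2, max_eq_right hs.1]
  have hmono : Monotone cl := fun x y hxy => by
    simp only [hcl_def]; gcongr
  have key := eq_of_isClosed_sublevel (E := fun s => E (cl s)) (fun K => ?_)
    (fun a b K hab hK => ?_) t 0
  · simpa [hid t ⟨ht.1, le_rfl⟩, hid 0 ⟨le_rfl, ht.1⟩] using key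
  · have := (hcl t ht.2 K).preimage hclc
    convert this using 1
    ext s
    simp [hmem s, -mem_Icc]
  · refine hE _ _ K (hmem a).1 (hmono hab) ((hmem b).2.trans_lt ht.2) fun s hs => ?_
    have hs' : s ∈ Icc 0 t := ⟨(hmem a).1.trans hs.1, hs.2.trans (hmem b).2⟩
    obtain ⟨r, hr, hrs⟩ := intermediate_value_Icc hab hclc.continuousOn hs
    have := hK r hr
    simpa [hrs] using this

section JointContinuity

variable {F F' : ℝ → ℝ → ℝ} {S : Set ℝ} {a b T : ℝ}

theorem continuous_slice (hF : ContinuousOn (fun p : ℝ × ℝ => F p.1 p.2) (S ×ˢ univ))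
    {t : ℝ} (ht : t ∈ S) : Continuous (F t) :=
  hF.comp_continuous (f := fun x : ℝ => ((t, x) : ℝ × ℝ)) (by fun_prop) fun _ => ⟨ht, mem_univ _⟩

theorem continuousOn_slice (hF : ContinuousOn (fun p : ℝ × ℝ => F p.1 p.2) (S ×ˢ univ))
    (x : ℝ) : ContinuousOn (fun s => F s x) S :=
  hF.comp (f := fun s : ℝ => ((s, x) : ℝ × ℝ)) (by fun_prop) fun _ hs => ⟨hs, mem_univ _⟩

theorem exists_continuous_extension (hab : a ≤ b)
    (hF : ContinuousOn (fun p : ℝ × ℝ => F p.1 p.2) (Icc a b ×ˢ univ)) :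
    ∃ H : ℝ → ℝ → ℝ, Continuous (Function.uncurry H) ∧ ∀ t ∈ Icc a b, H t = F t := by
  refine ⟨fun t => F (max a (min b t)), ?_, fun t ht => ?_⟩
  · exact hF.comp_continuous (f := fun p : ℝ × ℝ => ((max a (min b p.1), p.2) : ℝ × ℝ))
      (by fun_prop) fun p => ⟨⟨le_max_left _ _, max_le hab (min_le_left _ _)⟩, mem_univ _⟩
  · simp only [min_eq_right ht.2, max_eq_right ht.1]

theorem continuousOn_Icc_integral (hab : a ≤ b)
    (hF : ContinuousOn (fun p : ℝ × ℝ => F p.1 p.2) (Icc a b ×ˢ univ)) (c d : ℝ) :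
    ContinuousOn (fun t => ∫ x in c..d, F t x) (Icc a b) := by
  obtain ⟨H, hH, hHF⟩ := exists_continuous_extension hab hF
  refine (intervalIntegral.continuous_parametric_intervalIntegral_of_continuous'
    (μ := volume) hH c d).continuousOn.congr fun t ht => ?_
  simp only [hHF t ht]

theorem continuousOn_Ico_of_Icc {f : ℝ → ℝ}
    (h : ∀ b, 0 ≤ b → b < T → ContinuousOn f (Icc 0 b)) : ContinuousOn f (Ico 0 T) := by
  intro t ht
  obtain ⟨b, htb, hbT⟩ := exists_between ht.2
  refine ((h b (ht.1.trans htb.le) hbT) t ⟨ht.1, htb.le⟩).mono_of_mem_nhdsWithin ?_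
  filter_upwards [self_mem_nhdsWithin, mem_nhdsWithin_of_mem_nhds (Iio_mem_nhds htb)] with s hs hs'
    using ⟨hs.1, (mem_Iio.1 hs').le⟩

theorem continuousOn_Ico_integral
    (hF : ContinuousOn (fun p : ℝ × ℝ => F p.1 p.2) (Ico 0 T ×ˢ univ)) (c d : ℝ) :
    ContinuousOn (fun t => ∫ x in c..d, F t x) (Ico 0 T) :=
  continuousOn_Ico_of_Icc fun _ hb hbT => continuousOn_Icc_integral hb
    (hF.mono (prod_mono_left fun _ hs => ⟨hs.1, hs.2.trans_lt hbT⟩)) c d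

theorem integral_integral_swap_Icc (hab : a ≤ b)
    (hF : ContinuousOn (fun p : ℝ × ℝ => F p.1 p.2) (Icc a b ×ˢ univ)) (c d : ℝ) :
    ∫ x in c..d, ∫ t in a..b, F t x = ∫ t in a..b, ∫ x in c..d, F t x := by
  refine (intervalIntegral_intervalIntegral_swap ?_).symm
  rw [uIoc_of_le hab]
  refine ((hF.mono (prod_mono_right (subset_univ (uIcc c d)))).integrableOn_compact
    (isCompact_Icc.prod isCompact_uIcc)).mono_set ?_
  exact prod_mono Ioc_subset_Icc_self uIoc_subset_uIcc

theorem integral_time_deriv (ha : 0 ≤ a) (hab : a ≤ b) (hb : b < T)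
    (hF' : ContinuousOn (fun p : ℝ × ℝ => F' p.1 p.2) (Ico 0 T ×ˢ univ)) {x : ℝ}
    (hd : ∀ t ∈ Ico 0 T, HasDerivWithinAt (fun s => F s x) (F' t x) (Ico 0 T) t) :
    ∫ t in a..b, F' t x = F b x - F a x := by
  have hsub : Icc a b ⊆ Ico 0 T := fun s hs => ⟨ha.trans hs.1, hs.2.trans_lt hb⟩
  refine intervalIntegral.integral_eq_sub_of_hasDerivAt_of_le (f := fun s => F s x) hab
    (fun t ht => ((hd t (hsub ht)).continuousWithinAt).mono hsub) (fun t ht => ?_) ?_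
  · exact (hd t (hsub (Ioo_subset_Icc_self ht))).hasDerivAt
      (Ico_mem_nhds (ha.trans_lt ht.1) (ht.2.trans hb))
  · exact ((continuousOn_slice hF' x).mono hsub).intervalIntegrable_of_Icc hab

theorem hasDerivWithinAt_Ico_of_integral {f D : ℝ → ℝ} (hD : ContinuousOn D (Ico 0 T))
    (hf : ∀ t ∈ Ico 0 T, f t - f 0 = ∫ s in (0:ℝ)..t, D s) {t : ℝ} (ht : t ∈ Ico 0 T) :
    HasDerivWithinAt f (D t) (Ico 0 T) t := by
  obtain ⟨b, htb, hbT⟩ := exists_between ht.2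
  have hb : 0 ≤ b := ht.1.trans htb.le
  set D' : ℝ → ℝ := fun s => D (max 0 (min b s)) with hD'
  have hDc : Continuous D' := hD.comp_continuous (by fun_prop)
    fun s => ⟨le_max_left _ _, (max_le hb (min_le_left _ _)).trans_lt hbT⟩
  have hDD : ∀ s ∈ Icc 0 b, D' s = D s := fun s hs => by
    simp only [hD', min_eq_right hs.2, max_eq_right hs.1]
  have hd : HasDerivAt (fun r => f 0 + ∫ s in (0:ℝ)..r, D' s) (D' t) t :=
    (hDc.integral_hasStrictDerivAt 0 t).hasDerivAt.const_add (f 0)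
  rw [hDD t ⟨ht.1, htb.le⟩] at hd
  have hfe : ∀ r ∈ Icc 0 b, f r = f 0 + ∫ s in (0:ℝ)..r, D' s := fun r hr => by
    have h1 := hf r ⟨hr.1, hr.2.trans_lt hbT⟩
    have h2 : ∫ s in (0:ℝ)..r, D' s = ∫ s in (0:ℝ)..r, D s :=
      intervalIntegral.integral_congr fun s hs => by
        rw [uIcc_of_le hr.1] at hs
        exact hDD s ⟨hs.1, hs.2.trans hr.2⟩
    rw [h2]; linarith
  refine hd.hasDerivWithinAt.congr_of_eventuallyEq ?_ (hfe t ⟨ht.1, htb.le⟩)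
  filter_upwards [self_mem_nhdsWithin, mem_nhdsWithin_of_mem_nhds (Iio_mem_nhds htb)] with s hs hs'
    using hfe s ⟨hs.1, (mem_Iio.1 hs').le⟩

theorem integral_sub_integral_eq (ha : 0 ≤ a) (hab : a ≤ b) (hb : b < T)
    (hF : ContinuousOn (fun p : ℝ × ℝ => F p.1 p.2) (Ico 0 T ×ˢ univ))
    (hF' : ContinuousOn (fun p : ℝ × ℝ => F' p.1 p.2) (Ico 0 T ×ˢ univ))
    (hd : ∀ x, ∀ t ∈ Ico 0 T, HasDerivWithinAt (fun s => F s x) (F' t x) (Ico 0 T) t) (c d : ℝ) :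
    (∫ x in c..d, F b x) - ∫ x in c..d, F a x = ∫ t in a..b, ∫ x in c..d, F' t x := by
  have hsub : Icc a b ⊆ Ico 0 T := fun s hs => ⟨ha.trans hs.1, hs.2.trans_lt hb⟩
  rw [← integral_integral_swap_Icc hab (hF'.mono (prod_mono_left hsub)),
    ← intervalIntegral.integral_sub
      ((continuous_slice hF (hsub (right_mem_Icc.2 hab))).intervalIntegrable _ _)
      ((continuous_slice hF (hsub (left_mem_Icc.2 hab))).intervalIntegrable _ _)]
  exact intervalIntegral.integral_congr fun x _ => (integral_time_deriv ha hab hb hF' (hd x)).symm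

theorem hasDerivWithinAt_integral
    (hF : ContinuousOn (fun p : ℝ × ℝ => F p.1 p.2) (Ico 0 T ×ˢ univ))
    (hF' : ContinuousOn (fun p : ℝ × ℝ => F' p.1 p.2) (Ico 0 T ×ˢ univ))
    (hd : ∀ x, ∀ t ∈ Ico 0 T, HasDerivWithinAt (fun s => F s x) (F' t x) (Ico 0 T) t)
    (c d : ℝ) {t : ℝ} (ht : t ∈ Ico 0 T) :
    HasDerivWithinAt (fun s => ∫ x in c..d, F s x) (∫ x in c..d, F' t x) (Ico 0 T) t :=
  hasDerivWithinAt_Ico_of_integral (continuousOn_Ico_integral hF' c d)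
    (fun _ hs => integral_sub_integral_eq le_rfl hs.1 hs.2 hF hF' hd c d) ht

end JointContinuity

section MixedDerivative

variable {f fx fxx ft ftxx : ℝ → ℝ → ℝ} {T : ℝ}

theorem continuousOn_Ico_prod_of_Icc {g : ℝ × ℝ → ℝ}
    (h : ∀ b, 0 ≤ b → b < T → ContinuousOn g (Icc 0 b ×ˢ univ)) :
    ContinuousOn g (Ico 0 T ×ˢ univ) := by
  rintro ⟨t, x⟩ ⟨ht, -⟩
  obtain ⟨b, htb, hbT⟩ := exists_between ht.2
  refine ((h b (ht.1.trans htb.le) hbT) (t, x) ⟨⟨ht.1, htb.le⟩,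
    mem_univ _⟩).mono_of_mem_nhdsWithin ?_
  filter_upwards [self_mem_nhdsWithin, mem_nhdsWithin_of_mem_nhds
    (continuous_fst.continuousAt.preimage_mem_nhds (Iio_mem_nhds htb))] with s hs hs'
    using ⟨⟨hs.1.1, (mem_Iio.1 hs').le⟩, mem_univ _⟩

theorem continuousOn_Ico_primitive
    (hF : ContinuousOn (fun p : ℝ × ℝ => f p.1 p.2) (Ico 0 T ×ˢ univ)) (c : ℝ) :
    ContinuousOn (fun p : ℝ × ℝ => ∫ y in c..p.2, f p.1 y) (Ico 0 T ×ˢ univ) := by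
  refine continuousOn_Ico_prod_of_Icc fun b hb hbT => ?_
  obtain ⟨H, hH, hHF⟩ := exists_continuous_extension hb
    (hF.mono (prod_mono_left fun _ hs => ⟨hs.1, hs.2.trans_lt hbT⟩))
  refine (intervalIntegral.continuous_parametric_primitive_of_continuous
    (μ := volume) (a₀ := c) hH).continuousOn.congr fun p hp => ?_
  simp only [hHF p.1 hp.1]

/-- If `f` is twice differentiable in space, and `f` and `∂ₓ²f` are continuously differentiable in
time, then `∂ₓf` is differentiable in time and the mixed derivatives commute. -/
theorem exists_mixed_derivative
    (hx : ∀ t ∈ Ico 0 T, ∀ x, HasDerivAt (f t) (fx t x) x)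
    (hxx : ∀ t ∈ Ico 0 T, ∀ x, HasDerivAt (fx t) (fxx t x) x)
    (ht : ∀ x, ∀ t ∈ Ico 0 T, HasDerivWithinAt (fun s => f s x) (ft t x) (Ico 0 T) t)
    (htxx : ∀ x, ∀ t ∈ Ico 0 T, HasDerivWithinAt (fun s => fxx s x) (ftxx t x) (Ico 0 T) t)
    (cfx : ContinuousOn (fun p : ℝ × ℝ => fx p.1 p.2) (Ico 0 T ×ˢ univ))
    (cfxx : ContinuousOn (fun p : ℝ × ℝ => fxx p.1 p.2) (Ico 0 T ×ˢ univ))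
    (cft : ContinuousOn (fun p : ℝ × ℝ => ft p.1 p.2) (Ico 0 T ×ˢ univ))
    (cftxx : ContinuousOn (fun p : ℝ × ℝ => ftxx p.1 p.2) (Ico 0 T ×ˢ univ)) :
    ∃ ftx : ℝ → ℝ → ℝ,
      ContinuousOn (fun p : ℝ × ℝ => ftx p.1 p.2) (Ico 0 T ×ˢ univ) ∧
      (∀ x, ∀ t ∈ Ico 0 T, HasDerivWithinAt (fun s => fx s x) (ftx t x) (Ico 0 T) t) ∧
      (∀ t ∈ Ico 0 T, ∀ x, HasDerivAt (ft t) (ftx t x) x) ∧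
      (∀ t ∈ Ico 0 T, ∀ x, HasDerivAt (ftx t) (ftxx t x) x) := by
  have cwxx : ContinuousOn (fun p : ℝ × ℝ => (1 - p.2) * fxx p.1 p.2) (Ico 0 T ×ˢ univ) := by
    fun_prop
  have cwtxx : ContinuousOn (fun p : ℝ × ℝ => (1 - p.2) * ftxx p.1 p.2) (Ico 0 T ×ˢ univ) := by
    fun_prop
  have formula : ∀ t ∈ Ico 0 T, ∀ x, fx t x =
      f t 1 - f t 0 - (∫ z in (0:ℝ)..1, (1 - z) * fxx t z) + ∫ y in (0:ℝ)..x, fxx t y := by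
    intro t h x
    have h1 : ∫ y in (0:ℝ)..x, fxx t y = fx t x - fx t 0 :=
      intervalIntegral.integral_eq_sub_of_hasDerivAt (fun y _ => hxx t h y)
        ((continuous_slice cfxx h).intervalIntegrable _ _)
    have h2 : ∫ z in (0:ℝ)..1, (1 - z) * fxx t z =
        ((1 - 1) * fx t 1 + f t 1) - ((1 - 0) * fx t 0 + f t 0) := by
      refine intervalIntegral.integral_eq_sub_of_hasDerivAt
        (f := fun z => (1 - z) * fx t z + f t z) (fun z _ => ?_)
        ((continuous_slice (F := fun t z => (1 - z) * fxx t z) cwxx h).intervalIntegrable _ _)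
      have := (((hasDerivAt_id z).const_sub 1).mul (hxx t h z)).add (hx t h z)
      exact this.congr_deriv (by simp only [id]; ring)
    rw [h1, h2]; ring
  set ftx : ℝ → ℝ → ℝ := fun t x =>
    ft t 1 - ft t 0 - (∫ z in (0:ℝ)..1, (1 - z) * ftxx t z) + ∫ y in (0:ℝ)..x, ftxx t y with hftx
  have cftx : ContinuousOn (fun p : ℝ × ℝ => ftx p.1 p.2) (Ico 0 T ×ˢ univ) := by
    have h0 : ContinuousOn (fun t => ft t 1 - ft t 0 - ∫ z in (0:ℝ)..1, (1 - z) * ftxx t z)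
        (Ico 0 T) :=
      ((continuousOn_slice cft 1).sub (continuousOn_slice cft 0)).sub
        (continuousOn_Ico_integral (F := fun t z => (1 - z) * ftxx t z) cwtxx 0 1)
    exact (h0.comp continuousOn_fst fun p hp => hp.1).add (continuousOn_Ico_primitive cftxx 0)
  have dfx : ∀ x, ∀ t ∈ Ico 0 T, HasDerivWithinAt (fun s => fx s x) (ftx t x) (Ico 0 T) t := by
    intro x t h
    have h1 := hasDerivWithinAt_integral (F := fun t z => (1 - z) * fxx t z) cwxx cwtxx
      (fun z s hs => (htxx z s hs).const_mul _) 0 1 h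
    have h2 := hasDerivWithinAt_integral cfxx cftxx htxx 0 x h
    exact ((((ht 1 t h).sub (ht 0 t h)).sub h1).add h2).congr (fun s hs => formula s hs x)
      (formula t h x)
  refine ⟨ftx, cftx, dfx, fun t h x => ?_, fun t h x => ?_⟩
  · have key : ∀ y, ft t y = ft t 0 + ∫ z in (0:ℝ)..y, ftx t z := by
      intro y
      have h1 := hasDerivWithinAt_integral cfx cftx dfx 0 y h
      have h2 : HasDerivWithinAt (fun s => ∫ z in (0:ℝ)..y, fx s z) (ft t y - ft t 0)
          (Ico 0 T) t := by
        have h3 : ∀ s ∈ Ico 0 T, ∫ z in (0:ℝ)..y, fx s z = f s y - f s 0 := fun s hs =>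
          intervalIntegral.integral_eq_sub_of_hasDerivAt (fun y _ => hx s hs y)
            ((continuous_slice cfx hs).intervalIntegrable _ _)
        exact ((ht y t h).sub (ht 0 t h)).congr h3 (h3 t h)
      have h4 := (uniqueDiffOn_Ico 0 T t h).eq_deriv _ h1 h2
      linarith
    rw [show ft t = fun y => ft t 0 + ∫ z in (0:ℝ)..y, ftx t z from funext key]
    exact ((continuous_slice cftx h).integral_hasStrictDerivAt 0 x).hasDerivAt.const_add _
  · exact ((continuous_slice cftxx h).integral_hasStrictDerivAt 0 x).hasDerivAt.const_add _

end MixedDerivative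

/-- A classical solution of the R2CH system with `σ = 1`, `μ = 0` and `|ρ| ≤ M`, with all partial
derivatives named. -/
structure R2CHFlow (A Ω T M : ℝ) (u ux uxx uxxx ut utx ρ ρx : ℝ → ℝ → ℝ) : Prop where
  hasDerivAt_u : ∀ t ∈ Ico 0 T, ∀ x, HasDerivAt (u t) (ux t x) x
  hasDerivAt_ux : ∀ t ∈ Ico 0 T, ∀ x, HasDerivAt (ux t) (uxx t x) x
  hasDerivAt_uxx : ∀ t ∈ Ico 0 T, ∀ x, HasDerivAt (uxx t) (uxxx t x) x
  hasDerivAt_ρ : ∀ t ∈ Ico 0 T, ∀ x, HasDerivAt (ρ t) (ρx t x) x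
  hasDerivAt_ut : ∀ t ∈ Ico 0 T, ∀ x, HasDerivAt (ut t) (utx t x) x
  hasDerivAt_utx : ∀ t ∈ Ico 0 T, ∀ x, HasDerivAt (utx t)
    (ut t x - A * ux t x + 3 * u t x * ux t x - 2 * ux t x * uxx t x - u t x * uxxx t x
      + (1 - 2 * Ω * A) * ρ t x * ρx t x
      - 2 * Ω * ρ t x * (ρx t x * u t x + ρ t x * ux t x)) x
  time_u : ∀ x, ∀ t ∈ Ico 0 T, HasDerivWithinAt (fun s => u s x) (ut t x) (Ico 0 T) t
  time_ux : ∀ x, ∀ t ∈ Ico 0 T, HasDerivWithinAt (fun s => ux s x) (utx t x) (Ico 0 T) t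
  time_ρ : ∀ x, ∀ t ∈ Ico 0 T,
    HasDerivWithinAt (fun s => ρ s x) (-(ux t x * ρ t x + u t x * ρx t x)) (Ico 0 T) t
  cont_u : ContinuousOn (fun p : ℝ × ℝ => u p.1 p.2) (Ico 0 T ×ˢ univ)
  cont_ux : ContinuousOn (fun p : ℝ × ℝ => ux p.1 p.2) (Ico 0 T ×ˢ univ)
  cont_uxx : ContinuousOn (fun p : ℝ × ℝ => uxx p.1 p.2) (Ico 0 T ×ˢ univ)
  cont_ut : ContinuousOn (fun p : ℝ × ℝ => ut p.1 p.2) (Ico 0 T ×ˢ univ)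
  cont_utx : ContinuousOn (fun p : ℝ × ℝ => utx p.1 p.2) (Ico 0 T ×ˢ univ)
  cont_ρ : ContinuousOn (fun p : ℝ × ℝ => ρ p.1 p.2) (Ico 0 T ×ˢ univ)
  cont_ρx : ContinuousOn (fun p : ℝ × ℝ => ρx p.1 p.2) (Ico 0 T ×ˢ univ)
  integrable_energy : ∀ t ∈ Ico 0 T, Integrable fun x =>
    u t x ^ 2 + ux t x ^ 2 + (1 - 2 * Ω * A) * (ρ t x - 1) ^ 2
  u_atTop : ∀ t ∈ Ico 0 T, Tendsto (u t) atTop (𝓝 0)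
  u_atBot : ∀ t ∈ Ico 0 T, Tendsto (u t) atBot (𝓝 0)
  ux_bounded : ∀ t ∈ Ico 0 T, ∃ m, ∀ x, |ux t x| ≤ m
  ρ_le : ∀ t ∈ Ico 0 T, ∀ x, |ρ t x| ≤ M

theorem R2CHSolution.exists_flow {A Ω T M : ℝ} {u ρ : ℝ → ℝ → ℝ}
    (h : R2CHSolution A 0 1 Ω T u ρ) (hρM : ∀ t ∈ Ico (0:ℝ) T, ∀ x : ℝ, |ρ t x| ≤ M) :
    ∃ ut utx : ℝ → ℝ → ℝ, R2CHFlow A Ω T M u (fun t => deriv (u t))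
      (fun t => deriv (deriv (u t))) (fun t => deriv (deriv (deriv (u t)))) ut utx ρ
      (fun t => deriv (ρ t)) := by
  have du1 : ∀ t ∈ Ico 0 T, ∀ x, HasDerivAt (u t) (deriv (u t) x) x := fun t ht x =>
    ((h.u_smooth t ht).differentiable (by norm_num) x).hasDerivAt
  have cd2 : ∀ t ∈ Ico 0 T, ContDiff ℝ 2 (deriv (u t)) := fun t ht =>
    (h.u_smooth t ht).deriv' (n := 2)
  have cd1 : ∀ t ∈ Ico 0 T, ContDiff ℝ 1 (deriv (deriv (u t))) := fun t ht =>
    (cd2 t ht).deriv' (n := 1)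
  have du2 : ∀ t ∈ Ico 0 T, ∀ x, HasDerivAt (deriv (u t)) (deriv (deriv (u t)) x) x :=
    fun t ht x => ((cd2 t ht).differentiable (by norm_num) x).hasDerivAt
  have du3 : ∀ t ∈ Ico 0 T, ∀ x,
      HasDerivAt (deriv (deriv (u t))) (deriv (deriv (deriv (u t))) x) x :=
    fun t ht x => ((cd1 t ht).differentiable (by norm_num) x).hasDerivAt
  have dρ : ∀ t ∈ Ico 0 T, ∀ x, HasDerivAt (ρ t) (deriv (ρ t) x) x := fun t ht x =>
    ((h.ρ_smooth t ht).differentiable (by norm_num) x).hasDerivAt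
  have c0 := h.u_jcont 0 (by norm_num)
  have c1 := h.u_jcont 1 (by norm_num)
  have c2 := h.u_jcont 2 (by norm_num)
  have r0 := h.ρ_jcont 0 (by norm_num)
  have r1 := h.ρ_jcont 1 (by norm_num)
  simp only [iteratedDeriv_succ, iteratedDeriv_zero] at c0 c1 c2 r0 r1
  have tu : ∀ x, ∀ t ∈ Ico 0 T, HasDerivWithinAt (fun s => u s x)
      (derivWithin (fun s => u s x) (Ico 0 T) t) (Ico 0 T) t :=
    fun x t ht => (h.u_tdiff x t ht).hasDerivWithinAt
  have tuxx : ∀ x, ∀ t ∈ Ico 0 T, HasDerivWithinAt (fun s => deriv (deriv (u s)) x)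
      (derivWithin (fun s => deriv (deriv (u s)) x) (Ico 0 T) t) (Ico 0 T) t :=
    fun x t ht => (h.uxx_tdiff x t ht).hasDerivWithinAt
  obtain ⟨utx, cutx, tux, dut, dutx⟩ := exists_mixed_derivative
    (f := u) (fx := fun t => deriv (u t)) (fxx := fun t => deriv (deriv (u t)))
    (ft := fun t x => derivWithin (fun s => u s x) (Ico 0 T) t)
    (ftxx := fun t x => derivWithin (fun s => deriv (deriv (u s)) x) (Ico 0 T) t)
    du1 du2 tu tuxx c1 c2 h.ut_jcont h.utxx_jcont
  refine ⟨fun t x => derivWithin (fun s => u s x) (Ico 0 T) t, utx, ?_⟩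
  refine ⟨du1, du2, du3, dρ, dut, fun t ht x => ?_, tu, tux, fun x t ht => ?_, c0, c1, c2,
    h.ut_jcont, cutx, r0, r1, fun t ht => ?_, fun t ht => ?_, fun t ht => ?_, fun t ht => ?_, hρM⟩
  · convert dutx t ht x using 1
    have h1 := h.eq_u t ht x
    have h2 : deriv (fun y => ρ t y * u t y) x = deriv (ρ t) x * u t x + ρ t x * deriv (u t) x :=
      ((dρ t ht x).mul (du1 t ht x)).deriv
    rw [h2] at h1
    linarith
  · have h1 := h.eq_ρ t ht x
    have h2 : deriv (fun y => u t y * ρ t y) x = deriv (u t) x * ρ t x + u t x * deriv (ρ t) x :=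
      ((du1 t ht x).mul (dρ t ht x)).deriv
    rw [h2] at h1
    rw [show -(deriv (u t) x * ρ t x + u t x * deriv (ρ t) x)
      = derivWithin (fun s => ρ s x) (Ico 0 T) t by linarith]
    exact (h.ρ_tdiff x t ht).hasDerivWithinAt
  · exact ((h.u_L2 t ht).add (h.ux_L2 t ht)).add ((h.ρm1_L2 t ht).const_mul _)
  · exact (h.u_decay t ht).mono_left atTop_le_cocompact
  · exact (h.u_decay t ht).mono_left atBot_le_cocompact
  · have hc : Continuous (deriv (u t)) := (cd2 t ht).continuous
    have hb := (h.ux_decay t ht).norm.eventually (gt_mem_nhds (show ‖(0:ℝ)‖ < 1 by simp))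
    obtain ⟨K, hK, hKs⟩ := mem_cocompact.1 hb
    obtain ⟨m, hm⟩ := hK.exists_bound_of_continuousOn hc.continuousOn
    refine ⟨max m 1, fun x => ?_⟩
    by_cases hx : x ∈ K
    · exact (hm x hx).trans (le_max_left _ _)
    · exact (le_of_lt (hKs hx)).trans (le_max_right _ _)

section RealAnalysis

theorem sub_le_integral_of_deriv_le {g g' e : ℝ → ℝ} {a b : ℝ} (hab : a ≤ b)
    (hg : ∀ x, HasDerivAt g (g' x) x) (he : Integrable e) (hle : ∀ x ∈ Ioo a b, g' x ≤ e x) :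
    g b - g a ≤ ∫ x in a..b, e x :=
  intervalIntegral.sub_le_integral_of_hasDeriv_right_of_le hab
    (fun x _ => (hg x).continuousAt.continuousWithinAt) (fun x _ => (hg x).hasDerivWithinAt)
    he.integrableOn hle

theorem intervalIntegral_le_integral {e : ℝ → ℝ} {a b : ℝ} (hab : a ≤ b) (he : Integrable e)
    (h0 : ∀ x, 0 ≤ e x) : ∫ x in a..b, e x ≤ ∫ x, e x := by
  rw [intervalIntegral.integral_of_le hab]
  exact setIntegral_le_integral he (Eventually.of_forall h0)

/-- A one-dimensional Sobolev inequality. -/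
theorem sq_le_half_integral {f f' e : ℝ → ℝ} (hf : ∀ x, HasDerivAt f (f' x) x)
    (he : Integrable e) (hle : ∀ x, f x ^ 2 + f' x ^ 2 ≤ e x)
    (htop : Tendsto f atTop (𝓝 0)) (hbot : Tendsto f atBot (𝓝 0)) (x : ℝ) :
    f x ^ 2 ≤ (∫ y, e y) / 2 := by
  have h0 : ∀ y, 0 ≤ e y := fun y => (by positivity : 0 ≤ f y ^ 2 + f' y ^ 2).trans (hle y)
  have hd : ∀ y, HasDerivAt (fun y => f y ^ 2) (2 * f y * f' y) y := fun y =>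
    ((hf y).pow 2).congr_deriv (by norm_num)
  have hd' : ∀ y, HasDerivAt (fun y => -f y ^ 2) (-(2 * f y * f' y)) y := fun y => (hd y).neg
  have key : ∀ᶠ X in atTop, 2 * f x ^ 2 - (f X ^ 2 + f (-X) ^ 2) ≤ ∫ y, e y := by
    filter_upwards [eventually_ge_atTop |x|] with X hX
    have hx := abs_le.1 hX
    have h1 := sub_le_integral_of_deriv_le hx.1 hd he fun y _ => by
      nlinarith [hle y, sq_nonneg (f y - f' y)]
    have h2 := sub_le_integral_of_deriv_le hx.2 hd' he fun y _ => by
      nlinarith [hle y, sq_nonneg (f y + f' y)]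
    have h3 := intervalIntegral.integral_add_adjacent_intervals
      (he.intervalIntegrable (a := -X) (b := x)) (he.intervalIntegrable (a := x) (b := X))
    have h4 := intervalIntegral_le_integral (hx.1.trans hx.2) he h0
    linarith
  have hl : Tendsto (fun X => 2 * f x ^ 2 - (f X ^ 2 + f (-X) ^ 2)) atTop (𝓝 (2 * f x ^ 2)) := by
    simpa using ((htop.pow 2).add ((hbot.comp tendsto_neg_atTop_atBot).pow 2)).const_sub
      (2 * f x ^ 2)
  linarith [le_of_tendsto hl key]

theorem abs_sub_le_of_abs_deriv_le {φ φ' e : ℝ → ℝ} {x X C : ℝ} (hx : x ≤ X) (hC : 0 ≤ C)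
    (hφ : ∀ y, HasDerivAt φ (φ' y) y) (he : Integrable e)
    (hle : ∀ y ∈ Ioo x X, |φ' y| ≤ C * exp (x - y) + e y) :
    |φ X - φ x| ≤ C + ∫ y in x..X, e y := by
  have hexp : ∀ y, HasDerivAt (fun y => C * exp (x - y)) (-(C * exp (x - y))) y := fun y =>
    ((((hasDerivAt_id y).const_sub x).exp).const_mul C).congr_deriv (by simp)
  have h1 := sub_le_integral_of_deriv_le hx (fun y => (hφ y).add (hexp y)) he fun y hy => by
    linarith [(abs_le.1 (hle y hy)).2]
  have h2 := sub_le_integral_of_deriv_le hx (fun y => (hφ y).neg.add (hexp y)) he fun y hy => by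
    linarith [(abs_le.1 (hle y hy)).1]
  simp only [Pi.add_apply, Pi.neg_apply, sub_self, exp_zero, mul_one] at h1 h2
  have : 0 ≤ C * exp (x - X) := by positivity
  exact abs_le.2 ⟨by linarith, by linarith⟩

theorem exists_mem_Icc_integral_eq_mul {f : ℝ → ℝ} {a b : ℝ} (hab : a ≤ b)
    (hf : ContinuousOn f (Icc a b)) : ∃ c ∈ Icc a b, ∫ x in a..b, f x = f c * (b - a) := by
  obtain ⟨c, hc, h⟩ := exists_eq_const_mul_intervalIntegral_of_nonneg (f := f) (g := fun _ => 1)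
    (μ := volume) (by rwa [uIcc_of_le hab]) intervalIntegrable_const fun _ _ => zero_le_one
  exact ⟨c, by rwa [uIcc_of_le hab] at hc, by simpa using h⟩

theorem abs_le_of_abs_integral_le {f : ℝ → ℝ} {a b K : ℝ} (hab : a < b)
    (hf : ContinuousOn f (Icc a b))
    (h : ∀ s t, a ≤ s → s ≤ t → t ≤ b → |∫ r in s..t, f r| ≤ K * (t - s)) {t : ℝ}
    (ht : t ∈ Icc a b) : |f t| ≤ K := by
  by_contra! hlt
  have hev : ∀ᶠ s in 𝓝[Icc a b] t, K < |f s| := (hf t ht).abs.eventually (lt_mem_nhds hlt)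
  obtain ⟨δ, hδ, hball⟩ := Metric.mem_nhdsWithin_iff.1 hev
  have hlt' : max a (t - δ / 2) < min b (t + δ / 2) := by
    rw [max_lt_iff, lt_min_iff, lt_min_iff]
    exact ⟨⟨hab, by linarith [ht.1]⟩, by linarith [ht.2], by linarith⟩
  have hsub : Icc (max a (t - δ / 2)) (min b (t + δ / 2)) ⊆ Icc a b :=
    Icc_subset_Icc (le_max_left _ _) (min_le_left _ _)
  obtain ⟨c, hc, hi⟩ := exists_mem_Icc_integral_eq_mul hlt'.le (hf.mono hsub)
  have h1 := h _ _ (le_max_left a (t - δ / 2)) hlt'.le (min_le_left _ _)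
  rw [hi, abs_mul, abs_of_pos (sub_pos.2 hlt')] at h1
  have h2 := le_of_mul_le_mul_right h1 (sub_pos.2 hlt')
  have h3 : c ∈ Metric.ball t δ := by
    rw [Metric.mem_ball, Real.dist_eq, abs_lt]
    have h4 := (le_max_right _ _).trans hc.1
    have h5 := hc.2.trans (min_le_right _ _)
    constructor <;> linarith
  exact absurd h2 (not_le.2 (hball ⟨h3, hsub hc⟩))

/-- Solutions of `w' = z + G`, `z' = w - H` satisfy an approximate transport relation. -/
theorem abs_transport_le {w z G H e : ℝ → ℝ} {C K x X : ℝ} (hC : 0 ≤ C) (hx : x ≤ X)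
    (hw : ∀ y, HasDerivAt w (z y + G y) y) (hz : ∀ y, HasDerivAt z (w y - H y) y)
    (he : Integrable e) (he0 : ∀ y, 0 ≤ e y) (heK : ∫ y, e y ≤ K)
    (hle : ∀ y, |G y| + |H y| ≤ C + e y) :
    |2 * exp (x - X) * w X - (z x + w x) - exp (2 * (x - X)) * (w x - z x)| ≤ 2 * (C + K) := by
  have hK : ∫ y in x..X, e y ≤ K := (intervalIntegral_le_integral hx he he0).trans heK
  have h1 : |exp (x - X) * (z X + w X) - (z x + w x)| ≤ C + K := by
    have hd : ∀ y, HasDerivAt (fun y => exp (x - y) * (z y + w y))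
        (exp (x - y) * (G y - H y)) y := fun y =>
      (((hasDerivAt_id y).const_sub x).exp.mul ((hz y).add (hw y))).congr_deriv
        (by simp only [Pi.add_apply, id]; ring)
    have := abs_sub_le_of_abs_deriv_le hx hC hd he fun y hy => ?_
    · simp only [sub_self, exp_zero, one_mul] at this
      linarith
    · rw [abs_mul, abs_of_pos (exp_pos _)]
      have h2 : exp (x - y) ≤ 1 := exp_le_one_iff.2 (by linarith [hy.1])
      have h3 : |G y - H y| ≤ C + e y := (abs_sub _ _).trans (hle y)
      nlinarith [exp_pos (x - y), he0 y]
  have h2 : |exp (x - X) * (w X - z X) - exp (2 * (x - X)) * (w x - z x)| ≤ C + K := by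
    have hd : ∀ y, HasDerivAt (fun y => exp (x - 2 * X + y) * (w y - z y))
        (exp (x - 2 * X + y) * (G y + H y)) y := fun y =>
      (((hasDerivAt_id y).const_add (x - 2 * X)).exp.mul ((hw y).sub (hz y))).congr_deriv
        (by simp only [Pi.sub_apply, id]; ring)
    have := abs_sub_le_of_abs_deriv_le hx hC hd he fun y hy => ?_
    · rw [show x - X = x - 2 * X + X by ring, show 2 * (x - 2 * X + X) = x - 2 * X + x by ring]
      linarith
    · rw [abs_mul, abs_of_pos (exp_pos _)]
      have h2 : exp (x - 2 * X + y) ≤ 1 := exp_le_one_iff.2 (by linarith [hy.2])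
      have h4 : exp (x - 2 * X + y) ≤ exp (x - y) := exp_le_exp.2 (by linarith [hy.2])
      have h3 : |G y + H y| ≤ C + e y := (abs_add_le _ _).trans (hle y)
      nlinarith [exp_pos (x - 2 * X + y), he0 y]
  rw [show 2 * exp (x - X) * w X - (z x + w x) - exp (2 * (x - X)) * (w x - z x)
    = (exp (x - X) * (z X + w X) - (z x + w x))
      + (exp (x - X) * (w X - z X) - exp (2 * (x - X)) * (w x - z x)) by ring]
  exact (abs_add_le _ _).trans (by linarith)

theorem abs_add_le_of_transport {w z G H e : ℝ → ℝ → ℝ} {a b C K L : ℝ} (hab : a < b) (hC : 0 ≤ C)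
    (cw : ContinuousOn (fun p : ℝ × ℝ => w p.1 p.2) (Icc a b ×ˢ univ))
    (cz : ContinuousOn (fun p : ℝ × ℝ => z p.1 p.2) (Icc a b ×ˢ univ))
    (hw : ∀ t ∈ Icc a b, ∀ y, HasDerivAt (w t) (z t y + G t y) y)
    (hz : ∀ t ∈ Icc a b, ∀ y, HasDerivAt (z t) (w t y - H t y) y)
    (he : ∀ t ∈ Icc a b, Integrable (e t)) (he0 : ∀ t y, 0 ≤ e t y)
    (heK : ∀ t ∈ Icc a b, ∫ y, e t y ≤ K)
    (hle : ∀ t ∈ Icc a b, ∀ y, |G t y| + |H t y| ≤ C + e t y)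
    (hL : ∀ s t, a ≤ s → s ≤ t → t ≤ b → ∀ n, |∫ x in n..(n + 1), ∫ r in s..t, w r x| ≤ L)
    {t : ℝ} (ht : t ∈ Icc a b) (x : ℝ) : |z t x + w t x| ≤ 2 * (C + K) := by
  refine abs_le_of_abs_integral_le hab (f := fun t => z t x + w t x)
    ((continuousOn_slice cz x).add (continuousOn_slice cw x)) (fun t₁ t₂ h₁ h₁₂ h₂ => ?_) ht
  have hsub : Icc t₁ t₂ ⊆ Icc a b := Icc_subset_Icc h₁ h₂
  have ci : ∀ {f : ℝ → ℝ}, ContinuousOn f (Icc a b) → IntervalIntegrable f volume t₁ t₂ :=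
    fun hf => (hf.mono hsub).intervalIntegrable_of_Icc h₁₂
  have hwX : ∀ n : ℝ, ∃ X ∈ Icc n (n + 1), |∫ r in t₁..t₂, w r X| ≤ L := by
    intro n
    have hc : ContinuousOn (fun X => ∫ r in t₁..t₂, w r X) (Icc n (n + 1)) := by
      obtain ⟨W, hW, hWw⟩ := exists_continuous_extension h₁₂ (cw.mono (prod_mono_left hsub))
      have : Continuous fun X => ∫ r in t₁..t₂, W r X :=
        intervalIntegral.continuous_parametric_intervalIntegral_of_continuous'
          (f := fun X r => W r X) (by exact hW.comp continuous_swap) t₁ t₂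
      refine this.continuousOn.congr fun X _ => intervalIntegral.integral_congr fun r hr => ?_
      rw [uIcc_of_le h₁₂] at hr
      simp only [hWw r hr]
    obtain ⟨X, hX, hXe⟩ := exists_mem_Icc_integral_eq_mul (by linarith) hc
    refine ⟨X, hX, ?_⟩
    have := hL t₁ t₂ h₁ h₁₂ h₂ n
    rwa [hXe, add_sub_cancel_left, mul_one] at this
  choose X hX hXL using hwX
  set B : ℝ := |∫ r in t₁..t₂, (w r x - z r x)| with hB
  have key : ∀ᶠ n in atTop, |∫ r in t₁..t₂, (z r x + w r x)| ≤
      2 * (C + K) * (t₂ - t₁) + (2 * exp (x - X n) * L + exp (2 * (x - X n)) * B) := by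
    filter_upwards [eventually_ge_atTop x] with n hn
    have hb : |∫ r in t₁..t₂, (2 * exp (x - X n) * w r (X n) - (z r x + w r x)
        - exp (2 * (x - X n)) * (w r x - z r x))| ≤ 2 * (C + K) * (t₂ - t₁) := by
      have := intervalIntegral.norm_integral_le_of_norm_le_const (a := t₁) (b := t₂)
        (C := 2 * (C + K)) (f := fun r => 2 * exp (x - X n) * w r (X n) - (z r x + w r x)
        - exp (2 * (x - X n)) * (w r x - z r x)) fun r hr => ?_
      · rwa [abs_of_nonneg (sub_nonneg.2 h₁₂)] at this
      · rw [uIoc_of_le h₁₂] at hr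
        have hr' := hsub (Ioc_subset_Icc_self hr)
        exact abs_transport_le hC (hn.trans (hX n).1) (hw r hr') (hz r hr') (he r hr') (he0 r)
          (heK r hr') (hle r hr')
    have i1 := (ci (continuousOn_slice cw (X n))).const_mul (2 * exp (x - X n))
    have i2 : IntervalIntegrable (fun r => z r x + w r x) volume t₁ t₂ :=
      ci ((continuousOn_slice cz x).add (continuousOn_slice cw x))
    have i3 : IntervalIntegrable (fun r => exp (2 * (x - X n)) * (w r x - z r x)) volume t₁ t₂ :=
      (ci ((continuousOn_slice cw x).sub (continuousOn_slice cz x))).const_mul _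
    rw [intervalIntegral.integral_sub (i1.sub i2) i3, intervalIntegral.integral_sub i1 i2,
      intervalIntegral.integral_const_mul, intervalIntegral.integral_const_mul] at hb
    have h3 : |2 * exp (x - X n) * ∫ r in t₁..t₂, w r (X n)| ≤ 2 * exp (x - X n) * L := by
      rw [abs_mul, abs_of_pos (by positivity)]
      exact mul_le_mul_of_nonneg_left (hXL n) (by positivity)
    have h4 : |exp (2 * (x - X n)) * ∫ r in t₁..t₂, (w r x - z r x)|
        = exp (2 * (x - X n)) * B := by
      rw [abs_mul, abs_of_pos (exp_pos _)]
    have h5 := abs_le.1 h3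
    have h6 := abs_le.1 h4.le
    have h7 := abs_le.1 hb
    exact abs_le.2 ⟨by linarith, by linarith⟩
  have hXtop : Tendsto X atTop atTop := tendsto_atTop_mono (fun n => (hX n).1) tendsto_id
  have hsub' : Tendsto (fun n => x - X n) atTop atBot := by
    simpa [sub_eq_add_neg] using tendsto_atBot_add_const_left _ x
      (tendsto_neg_atTop_atBot.comp hXtop)
  have e1 : Tendsto (fun n => exp (x - X n)) atTop (𝓝 0) := tendsto_exp_atBot.comp hsub'
  have e2 : Tendsto (fun n => exp (2 * (x - X n))) atTop (𝓝 0) :=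
    tendsto_exp_atBot.comp (hsub'.const_mul_atBot (by norm_num))
  have hl : Tendsto (fun n => 2 * (C + K) * (t₂ - t₁)
      + (2 * exp (x - X n) * L + exp (2 * (x - X n)) * B)) atTop
      (𝓝 (2 * (C + K) * (t₂ - t₁))) := by
    simpa using (((e1.const_mul 2).mul_const L).add (e2.mul_const B)).const_add
      (2 * (C + K) * (t₂ - t₁))
  exact ge_of_tendsto hl key

theorem abs_sub_le_of_transport {w z G H e : ℝ → ℝ → ℝ} {a b C K L : ℝ} (hab : a < b) (hC : 0 ≤ C)
    (cw : ContinuousOn (fun p : ℝ × ℝ => w p.1 p.2) (Icc a b ×ˢ univ))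
    (cz : ContinuousOn (fun p : ℝ × ℝ => z p.1 p.2) (Icc a b ×ˢ univ))
    (hw : ∀ t ∈ Icc a b, ∀ y, HasDerivAt (w t) (z t y + G t y) y)
    (hz : ∀ t ∈ Icc a b, ∀ y, HasDerivAt (z t) (w t y - H t y) y)
    (he : ∀ t ∈ Icc a b, Integrable (e t)) (he0 : ∀ t y, 0 ≤ e t y)
    (heK : ∀ t ∈ Icc a b, ∫ y, e t y ≤ K)
    (hle : ∀ t ∈ Icc a b, ∀ y, |G t y| + |H t y| ≤ C + e t y)
    (hL : ∀ s t, a ≤ s → s ≤ t → t ≤ b → ∀ n, |∫ x in n..(n + 1), ∫ r in s..t, w r x| ≤ L)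
    {t : ℝ} (ht : t ∈ Icc a b) (x : ℝ) : |w t x - z t x| ≤ 2 * (C + K) := by
  have hm : ContinuousOn (fun p : ℝ × ℝ => (p.1, -p.2)) (Icc a b ×ˢ univ) := by fun_prop
  have hmt : MapsTo (fun p : ℝ × ℝ => (p.1, -p.2)) (Icc a b ×ˢ univ) (Icc a b ×ˢ univ) :=
    fun p hp => ⟨hp.1, mem_univ _⟩
  have h := abs_add_le_of_transport (w := fun t y => w t (-y)) (z := fun t y => -z t (-y))
    (G := fun t y => -G t (-y)) (H := fun t y => H t (-y)) (e := fun t y => e t (-y))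
    (L := L) (K := K) hab hC (cw.comp hm hmt) (cz.comp hm hmt).neg
    (fun s hs y => ?_) (fun s hs y => ?_) (fun s hs => (he s hs).comp_neg)
    (fun s y => he0 s _) (fun s hs => ?_) (fun s hs y => ?_) (fun s r h1 h2 h3 n => ?_) ht (-x)
  · rw [neg_neg] at h
    rwa [sub_eq_neg_add]
  · exact ((hw s hs (-y)).scomp y (hasDerivAt_neg y)).congr_deriv (by simp; ring)
  · exact ((hz s hs (-y)).scomp y (hasDerivAt_neg y)).neg.congr_deriv (by simp)
  · rw [integral_neg_eq_self (e s)]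
    exact heK s hs
  · simpa using hle s hs (-y)
  · rw [intervalIntegral.integral_comp_neg (fun x => ∫ r in s..r, w r x)]
    have := hL s r h1 h2 h3 (-(n + 1))
    rwa [show -(n + 1) + 1 = -n by ring] at this

end RealAnalysis

/-- The density of the energy. -/
noncomputable def energyDensity (A Ω : ℝ) (u ux ρ : ℝ → ℝ → ℝ) (t x : ℝ) : ℝ :=
  u t x ^ 2 + ux t x ^ 2 + (1 - 2 * Ω * A) * (ρ t x - 1) ^ 2

/-- Twice the local part of the convolution form of the equation. -/
noncomputable def pressure (A Ω : ℝ) (u ux ρ : ℝ → ℝ → ℝ) (t x : ℝ) : ℝ :=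
  u t x ^ 2 + ux t x ^ 2 / 2 - A * u t x + (1 - 2 * Ω * A) / 2 * (ρ t x ^ 2 - 1)
    - Ω * ρ t x ^ 2 * u t x

/-- The velocity of `∂ₓu` along characteristics, up to the Riccati term `-(∂ₓu)²/2`. -/
noncomputable def slopeForcing (u ux uxx utx : ℝ → ℝ → ℝ) (t x : ℝ) : ℝ :=
  utx t x + u t x * uxx t x + ux t x ^ 2 / 2

/-- The material derivative of the velocity. -/
noncomputable def acceleration (u ux ut : ℝ → ℝ → ℝ) (t x : ℝ) : ℝ :=
  ut t x + u t x * ux t x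

/-- The spatial derivative of the acceleration minus the pressure. -/
noncomputable def pressureDefect (A Ω : ℝ) (u ux uxx utx ρ : ℝ → ℝ → ℝ) (t x : ℝ) : ℝ :=
  utx t x + u t x * uxx t x + ux t x ^ 2 - pressure A Ω u ux ρ t x

namespace R2CHFlow

variable {A Ω T M : ℝ} {u ux uxx uxxx ut utx ρ ρx : ℝ → ℝ → ℝ} {a b K : ℝ}

theorem energyDensity_nonneg (hk : 0 < 1 - 2 * Ω * A) (t x : ℝ) :
    0 ≤ energyDensity A Ω u ux ρ t x := by
  unfold energyDensity; positivity

theorem continuousOn_energyDensity (h : R2CHFlow A Ω T M u ux uxx uxxx ut utx ρ ρx) :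
    ContinuousOn (fun p : ℝ × ℝ => energyDensity A Ω u ux ρ p.1 p.2) (Ico 0 T ×ˢ univ) := by
  have := h.cont_u
  have := h.cont_ux
  have := h.cont_ρ
  unfold energyDensity
  fun_prop

theorem continuousOn_slopeForcing (h : R2CHFlow A Ω T M u ux uxx uxxx ut utx ρ ρx) :
    ContinuousOn (fun p : ℝ × ℝ => slopeForcing u ux uxx utx p.1 p.2) (Ico 0 T ×ˢ univ) := by
  have := h.cont_u
  have := h.cont_ux
  have := h.cont_uxx
  have := h.cont_utx
  unfold slopeForcing
  fun_prop

theorem continuousOn_acceleration (h : R2CHFlow A Ω T M u ux uxx uxxx ut utx ρ ρx) :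
    ContinuousOn (fun p : ℝ × ℝ => acceleration u ux ut p.1 p.2) (Ico 0 T ×ˢ univ) := by
  have := h.cont_u
  have := h.cont_ux
  have := h.cont_ut
  unfold acceleration
  fun_prop

theorem continuousOn_pressureDefect (h : R2CHFlow A Ω T M u ux uxx uxxx ut utx ρ ρx) :
    ContinuousOn (fun p : ℝ × ℝ => pressureDefect A Ω u ux uxx utx ρ p.1 p.2)
      (Ico 0 T ×ˢ univ) := by
  have := h.cont_u
  have := h.cont_ux
  have := h.cont_uxx
  have := h.cont_utx
  have := h.cont_ρ
  unfold pressureDefect pressure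
  fun_prop

theorem hasDerivAt_acceleration (h : R2CHFlow A Ω T M u ux uxx uxxx ut utx ρ ρx) {t : ℝ}
    (ht : t ∈ Ico 0 T) (x : ℝ) : HasDerivAt (acceleration u ux ut t)
      (pressureDefect A Ω u ux uxx utx ρ t x + pressure A Ω u ux ρ t x) x :=
  ((h.hasDerivAt_ut t ht x).add ((h.hasDerivAt_u t ht x).mul (h.hasDerivAt_ux t ht x))).congr_deriv
    (by simp only [pressureDefect]; ring)

theorem hasDerivAt_pressureDefect (h : R2CHFlow A Ω T M u ux uxx uxxx ut utx ρ ρx) {t : ℝ}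
    (ht : t ∈ Ico 0 T) (x : ℝ) : HasDerivAt (pressureDefect A Ω u ux uxx utx ρ t)
      (acceleration u ux ut t x - Ω * ρ t x ^ 2 * ux t x) x := by
  have du := h.hasDerivAt_u t ht x
  have dux := h.hasDerivAt_ux t ht x
  have dρ := h.hasDerivAt_ρ t ht x
  have d1 := ((h.hasDerivAt_utx t ht x).add (du.mul (h.hasDerivAt_uxx t ht x))).add (dux.pow 2)
  have d2 := ((((du.pow 2).add ((dux.pow 2).div_const 2)).sub (du.const_mul A)).add
    (((dρ.pow 2).sub_const 1).const_mul ((1 - 2 * Ω * A) / 2))).sub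
    (((dρ.pow 2).const_mul Ω).mul du)
  refine (d1.sub d2).congr_deriv ?_
  simp only [acceleration, Pi.pow_apply]
  norm_num
  ring

theorem sq_le_half_energy (h : R2CHFlow A Ω T M u ux uxx uxxx ut utx ρ ρx)
    (hk : 0 < 1 - 2 * Ω * A) {t : ℝ} (ht : t ∈ Ico 0 T) (x : ℝ) :
    u t x ^ 2 ≤ (∫ y, energyDensity A Ω u ux ρ t y) / 2 :=
  sq_le_half_integral (h.hasDerivAt_u t ht) (h.integrable_energy t ht)
    (fun y => le_add_of_nonneg_right (by positivity)) (h.u_atTop t ht) (h.u_atBot t ht) x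

theorem abs_integral_acceleration_le (h : R2CHFlow A Ω T M u ux uxx uxxx ut utx ρ ρx)
    {U : ℝ} (ha : 0 ≤ a) (hab : a ≤ b) (hb : b < T) (hU : ∀ t ∈ Icc a b, ∀ x, |u t x| ≤ U) (n : ℝ) :
    |∫ x in n..(n + 1), ∫ t in a..b, acceleration u ux ut t x| ≤ 2 * U + U ^ 2 * (b - a) := by
  have hsub : Icc a b ⊆ Ico 0 T := fun s hs => ⟨ha.trans hs.1, hs.2.trans_lt hb⟩
  have cu := h.cont_u
  have cux := h.cont_ux
  have cuu : ContinuousOn (fun p : ℝ × ℝ => u p.1 p.2 * ux p.1 p.2) (Ico 0 T ×ˢ univ) := by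
    fun_prop
  have hin : ∀ t ∈ Icc a b, ∫ x in n..(n + 1), acceleration u ux ut t x
      = (∫ x in n..(n + 1), ut t x) + (u t (n + 1) ^ 2 - u t n ^ 2) / 2 := by
    intro t ht
    have ht' := hsub ht
    have h1 : ∫ x in n..(n + 1), u t x * ux t x = u t (n + 1) ^ 2 / 2 - u t n ^ 2 / 2 :=
      intervalIntegral.integral_eq_sub_of_hasDerivAt
        (f := fun x => u t x ^ 2 / 2)
        (fun x _ => (((h.hasDerivAt_u t ht' x).pow 2).div_const 2).congr_deriv (by norm_num; ring))
        ((continuous_slice (F := fun t x => u t x * ux t x) cuu ht').intervalIntegrable _ _)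
    simp only [acceleration]
    rw [intervalIntegral.integral_add ((continuous_slice h.cont_ut ht').intervalIntegrable _ _)
      ((continuous_slice (F := fun t x => u t x * ux t x) cuu ht').intervalIntegrable _ _), h1]
    ring
  rw [integral_integral_swap_Icc hab (h.continuousOn_acceleration.mono (prod_mono_left hsub)),
    intervalIntegral.integral_congr (g := fun t => (∫ x in n..(n + 1), ut t x)
      + (u t (n + 1) ^ 2 - u t n ^ 2) / 2) (fun t ht => hin t (by rwa [uIcc_of_le hab] at ht)),
    intervalIntegral.integral_add
      (((continuousOn_Ico_integral h.cont_ut n (n + 1)).mono hsub).intervalIntegrable_of_Icc hab)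
      (ContinuousOn.intervalIntegrable_of_Icc (u := fun t => (u t (n + 1) ^ 2 - u t n ^ 2) / 2) hab
        (((((continuousOn_slice cu (n + 1)).pow 2).sub
          ((continuousOn_slice cu n).pow 2)).div_const 2).mono hsub)),
    ← integral_sub_integral_eq ha hab hb cu h.cont_ut h.time_u]
  have hbd : ∀ t ∈ Icc a b, |∫ x in n..(n + 1), u t x| ≤ U := by
    intro t ht
    have := intervalIntegral.norm_integral_le_of_norm_le_const (a := n) (b := n + 1) (C := U)
      (f := u t) fun x _ => hU t ht x
    simpa using this
  have hbd2 : |∫ t in a..b, (u t (n + 1) ^ 2 - u t n ^ 2) / 2| ≤ U ^ 2 * (b - a) := by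
    have := intervalIntegral.norm_integral_le_of_norm_le_const (a := a) (b := b) (C := U ^ 2)
      (f := fun t => (u t (n + 1) ^ 2 - u t n ^ 2) / 2) fun t ht => ?_
    · rwa [abs_of_nonneg (sub_nonneg.2 hab)] at this
    · rw [uIoc_of_le hab] at ht
      have h1 := sq_le_sq' (abs_le.1 (hU t (Ioc_subset_Icc_self ht) n)).1
        (abs_le.1 (hU t (Ioc_subset_Icc_self ht) n)).2
      have h2 := sq_le_sq' (abs_le.1 (hU t (Ioc_subset_Icc_self ht) (n + 1))).1
        (abs_le.1 (hU t (Ioc_subset_Icc_self ht) (n + 1))).2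
      rw [Real.norm_eq_abs, abs_le]
      constructor <;> nlinarith [sq_nonneg (u t n), sq_nonneg (u t (n + 1))]
  have h1 := abs_le.1 (hbd a (left_mem_Icc.2 hab))
  have h2 := abs_le.1 (hbd b (right_mem_Icc.2 hab))
  have h3 := abs_le.1 hbd2
  exact abs_le.2 ⟨by linarith, by linarith⟩

theorem abs_pressure_sub_le (h : R2CHFlow A Ω T M u ux uxx uxxx ut utx ρ ρx)
    (hΩ : 0 ≤ Ω) (hk : 0 < 1 - 2 * Ω * A) {U t : ℝ} (ht : t ∈ Ico 0 T) (hU : ∀ x, |u t x| ≤ U)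
    (x : ℝ) : |pressure A Ω u ux ρ t x - ux t x ^ 2 / 2| ≤
      U ^ 2 + |A| * U + (1 - 2 * Ω * A) / 2 * (M ^ 2 + 1) + Ω * M ^ 2 * U := by
  have hρ := sq_le_sq' (abs_le.1 (h.ρ_le t ht x)).1 (abs_le.1 (h.ρ_le t ht x)).2
  have hu := sq_le_sq' (abs_le.1 (hU x)).1 (abs_le.1 (hU x)).2
  have hU0 : 0 ≤ U := (abs_nonneg _).trans (hU x)
  have h1 : |A * u t x| ≤ |A| * U := by
    rw [abs_mul]; exact mul_le_mul_of_nonneg_left (hU x) (abs_nonneg _)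
  have h2 : |Ω * ρ t x ^ 2 * u t x| ≤ Ω * M ^ 2 * U := by
    rw [abs_mul, abs_of_nonneg (by positivity)]
    exact mul_le_mul (by gcongr) (hU x) (abs_nonneg _) (by positivity)
  have h4 : |(1 - 2 * Ω * A) / 2 * (ρ t x ^ 2 - 1)| ≤ (1 - 2 * Ω * A) / 2 * (M ^ 2 + 1) := by
    rw [abs_mul, abs_of_nonneg (by positivity)]
    refine mul_le_mul_of_nonneg_left (abs_le.2 ⟨?_, ?_⟩) (by positivity) <;>
      nlinarith [sq_nonneg (ρ t x)]
  have h1 := abs_le.1 h1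
  have h2 := abs_le.1 h2
  have h4 := abs_le.1 h4
  unfold pressure
  exact abs_le.2 ⟨by linarith [sq_nonneg (u t x)], by linarith [sq_nonneg (u t x)]⟩

theorem abs_pressure_add_le (h : R2CHFlow A Ω T M u ux uxx uxxx ut utx ρ ρx)
    (hΩ : 0 ≤ Ω) (hk : 0 < 1 - 2 * Ω * A) {U t : ℝ} (ht : t ∈ Ico 0 T) (hU : ∀ x, |u t x| ≤ U)
    (x : ℝ) : |pressure A Ω u ux ρ t x| + |Ω * ρ t x ^ 2 * ux t x| ≤
      (U ^ 2 + |A| * U + (1 - 2 * Ω * A) / 2 * (M ^ 2 + 1) + Ω * M ^ 2 * U + (Ω * M ^ 2) ^ 2 / 2)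
        + energyDensity A Ω u ux ρ t x := by
  have hρ := sq_le_sq' (abs_le.1 (h.ρ_le t ht x)).1 (abs_le.1 (h.ρ_le t ht x)).2
  have h3 : |Ω * ρ t x ^ 2 * ux t x| ≤ (Ω * M ^ 2) ^ 2 / 2 + ux t x ^ 2 / 2 := by
    have : |Ω * ρ t x ^ 2 * ux t x| ≤ Ω * M ^ 2 * |ux t x| := by
      rw [abs_mul, abs_of_nonneg (by positivity)]
      gcongr
    nlinarith [sq_nonneg (Ω * M ^ 2 - |ux t x|), sq_abs (ux t x)]
  have h5 : |pressure A Ω u ux ρ t x| ≤ |pressure A Ω u ux ρ t x - ux t x ^ 2 / 2|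
      + ux t x ^ 2 / 2 := by
    have := abs_add_le (pressure A Ω u ux ρ t x - ux t x ^ 2 / 2) (ux t x ^ 2 / 2)
    rwa [sub_add_cancel, abs_of_nonneg (by positivity : 0 ≤ ux t x ^ 2 / 2)] at this
  have h6 : ux t x ^ 2 ≤ energyDensity A Ω u ux ρ t x := by
    unfold energyDensity
    have : 0 ≤ (1 - 2 * Ω * A) * (ρ t x - 1) ^ 2 := by positivity
    nlinarith [sq_nonneg (u t x)]
  linarith [h.abs_pressure_sub_le hΩ hk ht hU x]

theorem exists_abs_le (h : R2CHFlow A Ω T M u ux uxx uxxx ut utx ρ ρx)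
    (hΩ : 0 ≤ Ω) (hk : 0 < 1 - 2 * Ω * A) (ha : 0 ≤ a) (hab : a < b) (hb : b < T)
    (hE : ∀ t ∈ Icc a b, ∫ x, energyDensity A Ω u ux ρ t x ≤ K) :
    ∃ C, ∀ t ∈ Icc a b, ∀ x, |u t x| ≤ C ∧
      |pressureDefect A Ω u ux uxx utx ρ t x + acceleration u ux ut t x| ≤ C ∧
      |acceleration u ux ut t x - pressureDefect A Ω u ux uxx utx ρ t x| ≤ C := by
  have hsub : Icc a b ⊆ Ico 0 T := fun s hs => ⟨ha.trans hs.1, hs.2.trans_lt hb⟩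
  set U := sqrt (K / 2) with hU_def
  have hU : ∀ t ∈ Icc a b, ∀ x, |u t x| ≤ U := fun t ht x =>
    abs_le_sqrt ((h.sq_le_half_energy hk (hsub ht) x).trans (by linarith [hE t ht]))
  have hU0 : 0 ≤ U := sqrt_nonneg _
  set C := U ^ 2 + |A| * U + (1 - 2 * Ω * A) / 2 * (M ^ 2 + 1) + Ω * M ^ 2 * U
    + (Ω * M ^ 2) ^ 2 / 2 with hC
  have hC0 : 0 ≤ C := by positivity
  have hL : ∀ s t, a ≤ s → s ≤ t → t ≤ b → ∀ n,
      |∫ x in n..(n + 1), ∫ r in s..t, acceleration u ux ut r x| ≤ 2 * U + U ^ 2 * (b - a) := by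
    intro s t h1 h2 h3 n
    refine (h.abs_integral_acceleration_le (ha.trans h1) h2 (h3.trans_lt hb)
      (fun r hr => hU r ⟨h1.trans hr.1, hr.2.trans h3⟩) n).trans ?_
    gcongr
  refine ⟨max U (2 * (C + K)), fun t ht x => ⟨(hU t ht x).trans (le_max_left _ _), ?_, ?_⟩⟩
  · exact (abs_add_le_of_transport hab hC0 (h.continuousOn_acceleration.mono (prod_mono_left hsub))
      (h.continuousOn_pressureDefect.mono (prod_mono_left hsub))
      (fun t ht => h.hasDerivAt_acceleration (hsub ht))
      (H := fun t x => Ω * ρ t x ^ 2 * ux t x)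
      (fun t ht => h.hasDerivAt_pressureDefect (hsub ht))
      (fun t ht => h.integrable_energy t (hsub ht)) (fun t x => energyDensity_nonneg hk t x) hE
      (fun t ht => h.abs_pressure_add_le hΩ hk (hsub ht) (hU t ht)) hL ht x).trans
      (le_max_right _ _)
  · exact (abs_sub_le_of_transport hab hC0 (h.continuousOn_acceleration.mono (prod_mono_left hsub))
      (h.continuousOn_pressureDefect.mono (prod_mono_left hsub))
      (fun t ht => h.hasDerivAt_acceleration (hsub ht))
      (H := fun t x => Ω * ρ t x ^ 2 * ux t x)
      (fun t ht => h.hasDerivAt_pressureDefect (hsub ht))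
      (fun t ht => h.integrable_energy t (hsub ht)) (fun t x => energyDensity_nonneg hk t x) hE
      (fun t ht => h.abs_pressure_add_le hΩ hk (hsub ht) (hU t ht)) hL ht x).trans
      (le_max_right _ _)

theorem exists_abs_slopeForcing_le (h : R2CHFlow A Ω T M u ux uxx uxxx ut utx ρ ρx)
    (hΩ : 0 ≤ Ω) (hk : 0 < 1 - 2 * Ω * A) (ha : 0 ≤ a) (hab : a < b) (hb : b < T)
    (hE : ∀ t ∈ Icc a b, ∫ x, energyDensity A Ω u ux ρ t x ≤ K) :
    ∃ C, ∀ t ∈ Icc a b, ∀ x, |u t x| ≤ C ∧ |slopeForcing u ux uxx utx t x| ≤ C := by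
  have hsub : Icc a b ⊆ Ico 0 T := fun s hs => ⟨ha.trans hs.1, hs.2.trans_lt hb⟩
  obtain ⟨C, hC⟩ := h.exists_abs_le hΩ hk ha hab hb hE
  refine ⟨max C (C + (C ^ 2 + |A| * C + (1 - 2 * Ω * A) / 2 * (M ^ 2 + 1) + Ω * M ^ 2 * C)),
    fun t ht x => ⟨(hC t ht x).1.trans (le_max_left _ _), le_trans ?_ (le_max_right _ _)⟩⟩
  have h1 := abs_le.1 (hC t ht x).2.1
  have h2 := abs_le.1 (hC t ht x).2.2
  have h3 := abs_le.1 (h.abs_pressure_sub_le hΩ hk (hsub ht) (fun x => (hC t ht x).1) x)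
  have h4 : slopeForcing u ux uxx utx t x = pressureDefect A Ω u ux uxx utx ρ t x
      + (pressure A Ω u ux ρ t x - ux t x ^ 2 / 2) := by
    unfold slopeForcing pressureDefect; ring
  rw [h4]
  exact abs_le.2 ⟨by linarith, by linarith⟩

end R2CHFlow

theorem hasDerivAt_along_curve {F Fx Ft : ℝ → ℝ → ℝ} {T t q' : ℝ} {q : ℝ → ℝ}
    (hx : ∀ t ∈ Ico 0 T, ∀ x, HasDerivAt (F t) (Fx t x) x)
    (ht : ∀ x, ∀ t ∈ Ico 0 T, HasDerivWithinAt (fun s => F s x) (Ft t x) (Ico 0 T) t)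
    (cx : ContinuousOn (fun p : ℝ × ℝ => Fx p.1 p.2) (Ico 0 T ×ˢ univ))
    (ct : ContinuousOn (fun p : ℝ × ℝ => Ft p.1 p.2) (Ico 0 T ×ˢ univ))
    (htT : t ∈ Ioo 0 T) (hq : HasDerivAt q q' t) :
    HasDerivAt (fun s => F s (q s)) (Ft t (q t) + q' * Fx t (q t)) t := by
  have hnhds : ∀ᶠ v : ℝ × ℝ in 𝓝 (t, q t), v.1 ∈ Ioo 0 T :=
    continuous_fst.continuousAt.eventually (Ioo_mem_nhds htT.1 htT.2)
  have hmem : Ico 0 T ×ˢ univ ∈ 𝓝 ((t, q t) : ℝ × ℝ) := by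
    filter_upwards [hnhds] with v hv using ⟨Ioo_subset_Ico_self hv, mem_univ _⟩
  have key := hasStrictFDerivAt_uncurry_coprod (𝕜 := ℝ) (u := ((t, q t) : ℝ × ℝ)) (f := F)
    (f₁ := fun s x => ContinuousLinearMap.toSpanSingleton ℝ (Ft s x))
    (f₂ := fun s x => ContinuousLinearMap.toSpanSingleton ℝ (Fx s x)) ?_ ?_ ?_ ?_
  · have hp : HasDerivAt (fun s => ((s, q s) : ℝ × ℝ)) (1, q') t := (hasDerivAt_id t).prodMk hq
    have := key.hasFDerivAt.comp_hasDerivAt t hp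
    refine this.congr_deriv ?_
    simp [Function.HasUncurry.uncurry]
  · filter_upwards [hnhds] with v hv
    exact ((ht v.2 v.1 (Ioo_subset_Ico_self hv)).hasDerivAt (Ico_mem_nhds hv.1 hv.2)).hasFDerivAt
  · filter_upwards [hnhds] with v hv
    exact (hx v.1 (Ioo_subset_Ico_self hv) v.2).hasFDerivAt
  · exact (ContinuousLinearMap.toSpanSingletonCLE (𝕜 := ℝ) (E := ℝ)).continuous.continuousAt.comp
      (f := fun p : ℝ × ℝ => Ft p.1 p.2) (ct.continuousAt hmem)
  · exact (ContinuousLinearMap.toSpanSingletonCLE (𝕜 := ℝ) (E := ℝ)).continuous.continuousAt.comp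
      (f := fun p : ℝ × ℝ => Fx p.1 p.2) (cx.continuousAt hmem)

/-- A bounded continuous velocity field with continuous spatial derivative has global integral
curves. -/
theorem exists_integral_curve {v vx : ℝ → ℝ → ℝ} {a b L : ℝ}
    (hv : ∀ t ∈ Icc a b, ∀ x, HasDerivAt (v t) (vx t x) x)
    (cv : ContinuousOn (fun p : ℝ × ℝ => v p.1 p.2) (Icc a b ×ˢ univ))
    (cvx : ContinuousOn (fun p : ℝ × ℝ => vx p.1 p.2) (Icc a b ×ˢ univ))
    (hL : ∀ t ∈ Icc a b, ∀ x, |v t x| ≤ L) {t : ℝ} (ht : t ∈ Icc a b) (x : ℝ) :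
    ∃ q : ℝ → ℝ, q t = x ∧ ∀ s ∈ Icc a b, HasDerivWithinAt q (v s (q s)) (Icc a b) s := by
  have hL0 : 0 ≤ L := (abs_nonneg _).trans (hL t ht x)
  have hab : 0 ≤ b - a := by linarith [ht.1, ht.2]
  set r : ℝ := L * (b - a) with hr
  have hr0 : 0 ≤ r := by positivity
  obtain ⟨m, hm⟩ := (isCompact_Icc.prod (isCompact_closedBall x r)).exists_bound_of_continuousOn
    (cvx.mono (prod_mono_right (subset_univ _)))
  have hp : IsPicardLindelof v (tmin := a) (tmax := b) ⟨t, ht⟩ x ⟨r, hr0⟩ 0 ⟨L, hL0⟩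
      (Real.toNNReal m) :=
    { lipschitzOnWith := fun s hs =>
        (convex_closedBall x r).lipschitzOnWith_of_nnnorm_hasDerivWithin_le
          (fun y _ => (hv s hs y).hasDerivWithinAt) fun y hy => by
            rw [← NNReal.coe_le_coe, coe_nnnorm]
            exact (hm (s, y) ⟨hs, hy⟩).trans (Real.le_coe_toNNReal m)
      continuousOn := fun y _ => continuousOn_slice cv y
      norm_le := fun s hs y _ => hL s hs y
      mul_max_le := by
        simp only [NNReal.coe_zero, sub_zero, hr]
        exact mul_le_mul_of_nonneg_left (max_le (by linarith [ht.1]) (by linarith [ht.2])) hL0 }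
  exact hp.exists_eq_forall_mem_Icc_hasDerivWithinAt₀

namespace R2CHFlow

variable {A Ω T M : ℝ} {u ux uxx uxxx ut utx ρ ρx : ℝ → ℝ → ℝ} {a b C : ℝ}

theorem abs_arctan_sub_le (h : R2CHFlow A Ω T M u ux uxx uxxx ut utx ρ ρx)
    (ha : 0 ≤ a) (hb : b < T) (hC : ∀ t ∈ Icc a b, ∀ x, |slopeForcing u ux uxx utx t x| ≤ C)
    {q : ℝ → ℝ} (hq : ∀ s ∈ Icc a b, HasDerivWithinAt q (u s (q s)) (Icc a b) s)
    {s t : ℝ} (hs : s ∈ Icc a b) (ht : t ∈ Icc a b) :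
    |arctan (ux t (q t)) - arctan (ux s (q s))| ≤ (C + 1 / 2) * |t - s| := by
  wlog hst : s ≤ t generalizing s t
  · rw [abs_sub_comm, abs_sub_comm t]
    exact this ht hs (not_le.1 hst).le
  rcases hst.eq_or_lt with rfl | hst
  · simp
  have hsub : Icc s t ⊆ Icc a b := Icc_subset_Icc hs.1 ht.2
  have hsubT : Icc a b ⊆ Ico 0 T := fun r hr => ⟨ha.trans hr.1, hr.2.trans_lt hb⟩
  have hcq : ContinuousOn q (Icc a b) := fun r hr => (hq r hr).continuousWithinAt
  have hc : ContinuousOn (fun r => arctan (ux r (q r))) (Icc s t) := by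
    refine continuous_arctan.comp_continuousOn ?_
    exact h.cont_ux.comp (f := fun r => ((r, q r) : ℝ × ℝ))
      (continuousOn_id.prodMk (hcq.mono hsub)) fun r hr => ⟨hsubT (hsub hr), mem_univ _⟩
  obtain ⟨c, hc', hce⟩ := exists_hasDerivAt_eq_slope (fun r => arctan (ux r (q r)))
    (fun r => 1 / (1 + ux r (q r) ^ 2) * (utx r (q r) + u r (q r) * uxx r (q r))) hst hc
    fun r hr => by
      have hr' : r ∈ Ioo a b := ⟨hs.1.trans_lt hr.1, hr.2.trans_le ht.2⟩
      exact (hasDerivAt_along_curve h.hasDerivAt_ux h.time_ux h.cont_uxx h.cont_utx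
        ⟨ha.trans_lt hr'.1, hr'.2.trans hb⟩
        ((hq r (Ioo_subset_Icc_self hr')).hasDerivAt (Icc_mem_nhds hr'.1 hr'.2))).arctan
  have hcab : c ∈ Icc a b := hsub (Ioo_subset_Icc_self hc')
  have hQ := abs_le.1 (hC c hcab (q c))
  have hC0 : 0 ≤ C := (abs_nonneg _).trans (hC c hcab (q c))
  have hd : |1 / (1 + ux c (q c) ^ 2) * (utx c (q c) + u c (q c) * uxx c (q c))| ≤ C + 1 / 2 := by
    have h1 : utx c (q c) + u c (q c) * uxx c (q c)
        = slopeForcing u ux uxx utx c (q c) - ux c (q c) ^ 2 / 2 := by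
      unfold slopeForcing; ring
    have h2 : 0 < 1 + ux c (q c) ^ 2 := by positivity
    rw [h1, one_div, inv_mul_eq_div, abs_div, abs_of_pos h2, div_le_iff₀ h2, abs_le]
    constructor <;> nlinarith [mul_nonneg hC0 (sq_nonneg (ux c (q c)))]
  have hts : 0 < t - s := sub_pos.2 hst
  rw [abs_of_pos hts, ← div_le_iff₀ hts]
  rw [hce, abs_div, abs_of_pos hts] at hd
  exact hd

theorem exists_abs_ux_le (h : R2CHFlow A Ω T M u ux uxx uxxx ut utx ρ ρx)
    (ha : 0 ≤ a) (hb : b < T)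
    (hC : ∀ t ∈ Icc a b, ∀ x, |u t x| ≤ C ∧ |slopeForcing u ux uxx utx t x| ≤ C) :
    ∃ m, ∀ t ∈ Icc a b, ∀ x, |ux t x| ≤ m := by
  have hsubT : Icc a b ⊆ Ico 0 T := fun r hr => ⟨ha.trans hr.1, hr.2.trans_lt hb⟩
  refine isCompact_Icc.induction_on (p := fun S => ∃ m, ∀ t ∈ S, ∀ x, |ux t x| ≤ m)
    ⟨0, by simp⟩ ?_ ?_ fun t₀ ht₀ => ?_
  · rintro S S' hSS' ⟨m, hm⟩
    exact ⟨m, fun t ht => hm t (hSS' ht)⟩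
  · rintro S S' ⟨m, hm⟩ ⟨m', hm'⟩
    refine ⟨max m m', fun t ht x => ?_⟩
    rcases ht with ht | ht
    · exact (hm t ht x).trans (le_max_left _ _)
    · exact (hm' t ht x).trans (le_max_right _ _)
  obtain ⟨m, hm⟩ := h.ux_bounded t₀ (hsubT ht₀)
  obtain ⟨B, hmB, hB⟩ := exists_between (arctan_lt_pi_div_two m)
  have hlim : Tendsto (fun t => arctan m + (C + 1 / 2) * |t - t₀|) (𝓝 t₀) (𝓝 (arctan m)) := by
    have : Continuous fun t => arctan m + (C + 1 / 2) * |t - t₀| := by fun_prop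
    simpa using this.tendsto t₀
  have hev : {t | arctan m + (C + 1 / 2) * |t - t₀| < B} ∈ 𝓝 t₀ :=
    hlim.eventually (gt_mem_nhds hmB)
  have hBneg : -(π / 2) < B := (neg_pi_div_two_lt_arctan m).trans hmB
  refine ⟨_, inter_mem_nhdsWithin _ hev, tan B, fun t ht x => ?_⟩
  obtain ⟨q, hqt, hq⟩ := exists_integral_curve (fun s hs => h.hasDerivAt_u s (hsubT hs))
    (h.cont_u.mono (prod_mono_left hsubT)) (h.cont_ux.mono (prod_mono_left hsubT))
    (fun s hs x => (hC s hs x).1) ht.1 x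
  have h1 := abs_le.1 (h.abs_arctan_sub_le ha hb (fun s hs x => (hC s hs x).2) hq ht₀ ht.1)
  have h2 : arctan m + (C + 1 / 2) * |t - t₀| < B := ht.2
  have h3 := abs_le.1 (hm (q t₀))
  have h4 := arctan_strictMono.monotone h3.2
  have h5 := arctan_strictMono.monotone h3.1
  rw [arctan_neg] at h5
  rw [hqt] at h1
  have h6 : arctan (tan B) = B := arctan_tan hBneg hB
  rw [abs_le]
  constructor
  · rw [← arctan_strictMono.le_iff_le, arctan_neg, h6]; linarith
  · rw [← arctan_strictMono.le_iff_le, h6]; linarith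

end R2CHFlow

/-- Half the flux of the energy. -/
noncomputable def energyFlux (A Ω : ℝ) (u ux uxx utx ρ : ℝ → ℝ → ℝ) (t x : ℝ) : ℝ :=
  u t x * (slopeForcing u ux uxx utx t x - ux t x ^ 2 / 2) + A / 2 * u t x ^ 2 - u t x ^ 3
    + Ω * ρ t x ^ 2 * u t x ^ 2 - (1 - 2 * Ω * A) * (ρ t x - 1) * u t x * ρ t x

namespace R2CHFlow

variable {A Ω T M : ℝ} {u ux uxx uxxx ut utx ρ ρx : ℝ → ℝ → ℝ} {a b C K m : ℝ}

theorem continuousOn_energyFlux (h : R2CHFlow A Ω T M u ux uxx uxxx ut utx ρ ρx) :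
    ContinuousOn (fun p : ℝ × ℝ => energyFlux A Ω u ux uxx utx ρ p.1 p.2) (Ico 0 T ×ˢ univ) := by
  have := h.cont_u
  have := h.cont_ux
  have := h.cont_ρ
  have := h.continuousOn_slopeForcing
  unfold energyFlux
  fun_prop

theorem hasDerivAt_energyFlux (h : R2CHFlow A Ω T M u ux uxx uxxx ut utx ρ ρx) {t : ℝ}
    (ht : t ∈ Ico 0 T) (x : ℝ) : HasDerivAt (energyFlux A Ω u ux uxx utx ρ t)
      (u t x * ut t x + ux t x * utx t x
        - (1 - 2 * Ω * A) * (ρ t x - 1) * (ux t x * ρ t x + u t x * ρx t x)) x := by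
  have du := h.hasDerivAt_u t ht x
  have dux := h.hasDerivAt_ux t ht x
  have dρ := h.hasDerivAt_ρ t ht x
  have d1 := ((h.hasDerivAt_utx t ht x).add (du.mul (h.hasDerivAt_uxx t ht x))).add
    ((dux.pow 2).div_const 2)
  have d2 := ((((du.mul (d1.sub ((dux.pow 2).div_const 2))).add
    ((du.pow 2).const_mul (A / 2))).sub (du.pow 3)).add
    (((dρ.pow 2).const_mul Ω).mul (du.pow 2))).sub
    ((((dρ.sub_const 1).const_mul (1 - 2 * Ω * A)).mul du).mul dρ)
  refine d2.congr_deriv ?_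
  simp only [Pi.pow_apply, Pi.mul_apply, Pi.add_apply, Pi.sub_apply]
  norm_num
  ring

theorem abs_energyFlux_le (h : R2CHFlow A Ω T M u ux uxx uxxx ut utx ρ ρx)
    (hΩ : 0 ≤ Ω) (hk : 0 < 1 - 2 * Ω * A) {t x : ℝ} (ht : t ∈ Ico 0 T)
    (hu : |u t x| ≤ C) (hQ : |slopeForcing u ux uxx utx t x| ≤ C) (hm : |ux t x| ≤ m) :
    |energyFlux A Ω u ux uxx utx ρ t x| ≤ (C + m ^ 2 / 2 + |A| / 2 * C + C ^ 2 + Ω * M ^ 2 * C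
      + (1 - 2 * Ω * A) * (M + 1) * M) * |u t x| := by
  have hρ := h.ρ_le t ht x
  have hM : 0 ≤ M := (abs_nonneg _).trans hρ
  have hρ1 : |ρ t x - 1| ≤ M + 1 := (abs_sub _ _).trans (by simpa using hρ)
  have e : energyFlux A Ω u ux uxx utx ρ t x = (slopeForcing u ux uxx utx t x - ux t x ^ 2 / 2
      + A / 2 * u t x - u t x ^ 2 + Ω * ρ t x ^ 2 * u t x
      - (1 - 2 * Ω * A) * (ρ t x - 1) * ρ t x) * u t x := by
    unfold energyFlux; ring
  rw [e, abs_mul]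
  refine mul_le_mul_of_nonneg_right ?_ (abs_nonneg _)
  refine (abs_sub _ _).trans (add_le_add ((abs_add_le _ _).trans (add_le_add ((abs_sub _ _).trans
    (add_le_add ((abs_add_le _ _).trans (add_le_add ((abs_sub _ _).trans (add_le_add hQ ?_)) ?_))
    ?_)) ?_)) ?_)
  · rw [abs_div, abs_pow, abs_two]; gcongr
  · rw [abs_mul, abs_div, abs_two]; gcongr
  · rw [abs_pow]; gcongr
  · rw [abs_mul, abs_mul, abs_pow, abs_of_nonneg hΩ]; gcongr
  · rw [abs_mul, abs_mul, abs_of_pos hk]; gcongr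

theorem tendsto_integral_of_abs_le_mul (h : R2CHFlow A Ω T M u ux uxx uxxx ut utx ρ ρx)
    {J : ℝ → ℝ → ℝ} {B : ℝ} (ha : 0 ≤ a) (hab : a ≤ b) (hb : b < T)
    (cJ : ContinuousOn (fun p : ℝ × ℝ => J p.1 p.2) (Ico 0 T ×ˢ univ))
    (hu : ∀ t ∈ Icc a b, ∀ x, |u t x| ≤ C) (hJ : ∀ t ∈ Icc a b, ∀ x, |J t x| ≤ B * |u t x|) :
    Tendsto (fun R => ∫ t in a..b, (J t R - J t (-R))) atTop (𝓝 0) := by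
  have hsub : Icc a b ⊆ Ico 0 T := fun s hs => ⟨ha.trans hs.1, hs.2.trans_lt hb⟩
  have h0 : ∀ l : Filter ℝ, l.IsCountablyGenerated → (∀ t ∈ Ico 0 T, Tendsto (u t) l (𝓝 0)) →
      Tendsto (fun R => ∫ t in a..b, J t R) l (𝓝 0) := by
    intro l hl hul
    have key := intervalIntegral.tendsto_integral_filter_of_dominated_convergence
      (F := fun R t => J t R) (f := fun _ => (0 : ℝ)) (μ := volume) (a := a) (b := b) (l := l)
      (fun _ => |B| * C) ?_ ?_ intervalIntegrable_const ?_
    · simpa using key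
    · refine Eventually.of_forall fun R => ?_
      rw [uIoc_of_le hab]
      exact (((continuousOn_slice cJ R).mono hsub).mono
        Ioc_subset_Icc_self).aestronglyMeasurable measurableSet_Ioc
    · refine Eventually.of_forall fun R => Eventually.of_forall fun t ht => ?_
      rw [uIoc_of_le hab] at ht
      have ht := Ioc_subset_Icc_self ht
      exact (hJ t ht R).trans (mul_le_mul (le_abs_self B) (hu t ht R) (abs_nonneg _) (abs_nonneg _))
    · refine Eventually.of_forall fun t ht => ?_
      rw [uIoc_of_le hab] at ht
      have ht := Ioc_subset_Icc_self ht
      refine squeeze_zero_norm (fun R => hJ t ht R) ?_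
      simpa using (hul t (hsub ht)).abs.const_mul B
  have h1 := (h0 atTop inferInstance h.u_atTop).sub
    ((h0 atBot inferInstance h.u_atBot).comp tendsto_neg_atTop_atBot)
  rw [sub_zero] at h1
  refine h1.congr fun R => ?_
  rw [intervalIntegral.integral_sub]
  · rfl
  · exact ((continuousOn_slice cJ R).mono hsub).intervalIntegrable_of_Icc hab
  · exact ((continuousOn_slice cJ (-R)).mono hsub).intervalIntegrable_of_Icc hab

theorem energy_eq_of_le (h : R2CHFlow A Ω T M u ux uxx uxxx ut utx ρ ρx)
    (hΩ : 0 ≤ Ω) (hk : 0 < 1 - 2 * Ω * A) (ha : 0 ≤ a) (hab : a ≤ b) (hb : b < T)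
    (hE : ∀ t ∈ Icc a b, ∫ x, energyDensity A Ω u ux ρ t x ≤ K) :
    ∫ x, energyDensity A Ω u ux ρ a x = ∫ x, energyDensity A Ω u ux ρ b x := by
  rcases hab.eq_or_lt with rfl | hab'
  · rfl
  have hsub : Icc a b ⊆ Ico 0 T := fun s hs => ⟨ha.trans hs.1, hs.2.trans_lt hb⟩
  obtain ⟨C, hC⟩ := h.exists_abs_slopeForcing_le hΩ hk ha hab' hb hE
  obtain ⟨m, hm⟩ := h.exists_abs_ux_le ha hb hC
  have hlim := (h.tendsto_integral_of_abs_le_mul ha hab hb h.continuousOn_energyFlux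
    (fun t ht x => (hC t ht x).1)
    (fun t ht x => h.abs_energyFlux_le hΩ hk (hsub ht) (hC t ht x).1 (hC t ht x).2
      (hm t ht x))).const_mul 2
  have cu := h.cont_u
  have cux := h.cont_ux
  have cut := h.cont_ut
  have cutx := h.cont_utx
  have cρ := h.cont_ρ
  have cρx := h.cont_ρx
  set et : ℝ → ℝ → ℝ := fun t x => u t x * ut t x + ux t x * utx t x
        - (1 - 2 * Ω * A) * (ρ t x - 1) * (ux t x * ρ t x + u t x * ρx t x) with het
  have cet : ContinuousOn (fun p : ℝ × ℝ => et p.1 p.2) (Ico 0 T ×ˢ univ) := by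
    simp only [het]; fun_prop
  have key : ∀ R, (∫ x in (-R)..R, energyDensity A Ω u ux ρ b x)
      - ∫ x in (-R)..R, energyDensity A Ω u ux ρ a x
      = 2 * ∫ t in a..b, (energyFlux A Ω u ux uxx utx ρ t R
        - energyFlux A Ω u ux uxx utx ρ t (-R)) := by
    intro R
    rw [integral_sub_integral_eq (F := energyDensity A Ω u ux ρ) (F' := fun t x => 2 * et t x)
      ha hab hb h.continuousOn_energyDensity (by fun_prop) (fun x t ht => ?_),
      ← intervalIntegral.integral_const_mul]
    · refine intervalIntegral.integral_congr fun t ht => ?_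
      rw [uIcc_of_le hab] at ht
      replace ht := hsub ht
      rw [intervalIntegral.integral_const_mul,
        intervalIntegral.integral_eq_sub_of_hasDerivAt (fun x _ => h.hasDerivAt_energyFlux ht x)
        ((continuous_slice cet ht).intervalIntegrable _ _)]
    · refine ((((h.time_u x t ht).pow 2).add ((h.time_ux x t ht).pow 2)).add
        ((((h.time_ρ x t ht).sub_const 1).pow 2).const_mul (1 - 2 * Ω * A))).congr_deriv ?_
      simp only [het]
      norm_num
      ring
  have hI : ∀ t ∈ Icc a b, Tendsto (fun R => ∫ x in (-R)..R, energyDensity A Ω u ux ρ t x) atTop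
      (𝓝 (∫ x, energyDensity A Ω u ux ρ t x)) := fun t ht =>
    intervalIntegral_tendsto_integral (h.integrable_energy t (hsub ht)) tendsto_neg_atTop_atBot
      tendsto_id
  have h1 := (hI b (right_mem_Icc.2 hab)).sub (hI a (left_mem_Icc.2 hab))
  simp only [key] at h1
  have h2 := tendsto_nhds_unique h1 hlim
  linarith

theorem isClosed_energy_le (h : R2CHFlow A Ω T M u ux uxx uxxx ut utx ρ ρx)
    (hk : 0 < 1 - 2 * Ω * A) (hb : b < T) (K : ℝ) :
    IsClosed {t | t ∈ Icc 0 b ∧ ∫ x, energyDensity A Ω u ux ρ t x ≤ K} := by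
  have hsub : Icc 0 b ⊆ Ico 0 T := fun s hs => ⟨hs.1, hs.2.trans_lt hb⟩
  have he : {t | t ∈ Icc 0 b ∧ ∫ x, energyDensity A Ω u ux ρ t x ≤ K} = ⋂ R : Ici (0 : ℝ),
      {t | t ∈ Icc 0 b ∧ ∫ x in (-(R : ℝ))..R, energyDensity A Ω u ux ρ t x ≤ K} := by
    ext t
    simp only [mem_ofPred_eq, mem_iInter]
    constructor
    · rintro ⟨ht, hK⟩ ⟨R, hR⟩
      exact ⟨ht, (intervalIntegral_le_integral (by linarith [mem_Ici.1 hR])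
        (h.integrable_energy t (hsub ht)) fun x => energyDensity_nonneg hk t x).trans hK⟩
    · intro hR
      have ht := (hR ⟨0, self_mem_Ici⟩).1
      refine ⟨ht, le_of_tendsto (intervalIntegral_tendsto_integral
        (h.integrable_energy t (hsub ht)) tendsto_neg_atTop_atBot tendsto_id) ?_⟩
      filter_upwards [eventually_ge_atTop 0] with R hR0 using (hR ⟨R, hR0⟩).2
  rw [he]
  refine isClosed_iInter fun R => ?_
  exact ((continuousOn_Ico_integral h.continuousOn_energyDensity _ _).mono
    hsub).preimage_isClosed_of_isClosed isClosed_Icc isClosed_Iic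

theorem energy_eq (h : R2CHFlow A Ω T M u ux uxx uxxx ut utx ρ ρx)
    (hΩ : 0 ≤ Ω) (hk : 0 < 1 - 2 * Ω * A) {t : ℝ} (ht : t ∈ Ico 0 T) :
    ∫ x, energyDensity A Ω u ux ρ t x = ∫ x, energyDensity A Ω u ux ρ 0 x :=
  eqOn_Ico_of_isClosed_sublevel (E := fun t => ∫ x, energyDensity A Ω u ux ρ t x)
    (fun _ hb K => h.isClosed_energy_le hk hb K)
    (fun _ _ _ ha hab hb hE => h.energy_eq_of_le hΩ hk ha hab hb hE) ht

end R2CHFlow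

/-- The coefficient of the energy density in the pointwise bound of the nonlocal terms. -/
noncomputable def nonlocalCoeff (A Ω M S : ℝ) : ℝ :=
  A ^ 2 / 4 + Ω ^ 2 / 4 + Ω * S / (2 * (1 - 2 * Ω * A)) + Ω / (2 * √(1 - 2 * Ω * A))
    + Ω * (M + 1) / (4 * √(1 - 2 * Ω * A))

theorem half_mul_nonlocal_le {A Ω M S v p r θ : ℝ} (hΩ : 0 ≤ Ω) (hk : 0 < 1 - 2 * Ω * A)
    (hv : |v| ≤ S) (hr : |r| ≤ M) (hθ0 : 0 ≤ θ) (hθ1 : θ ≤ 1) :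
    θ / 2 * (Ω * r ^ 2 * (v + p) - (v + p) ^ 2 / 2 + A * p - (1 - 2 * Ω * A) / 2 * r ^ 2) ≤
      3 / 4 * θ ^ 2
        + nonlocalCoeff A Ω M S * (v ^ 2 + p ^ 2 + (1 - 2 * Ω * A) * (r - 1) ^ 2) := by
  unfold nonlocalCoeff
  set k := 1 - 2 * Ω * A with hk_def
  clear_value k
  have hs : 0 < √k := sqrt_pos.2 hk
  have hsk : √k ^ 2 = k := sq_sqrt hk.le
  have hS0 : 0 ≤ S := (abs_nonneg _).trans hv
  have hM0 : 0 ≤ M := (abs_nonneg _).trans hr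
  set s := √k
  clear_value s
  set η := r - 1 with hη
  have hrη : r = η + 1 := by rw [hη]; ring
  have hr1 : |η + 2| ≤ M + 1 := by
    rw [show η + 2 = r + 1 by rw [hη]; ring]
    exact (abs_add_le _ _).trans (by simpa using hr)
  clear_value η
  subst hrη
  have young : ∀ y : ℝ, |η| * |y| ≤ (k * η ^ 2 + y ^ 2) / (2 * s) := fun y => by
    rw [le_div_iff₀ (by positivity), ← hsk, ← sq_abs η, ← sq_abs y]
    nlinarith [sq_nonneg (s * |η| - |y|)]
  have h1 : θ / 2 * (A * p) ≤ θ ^ 2 / 4 + A ^ 2 / 4 * p ^ 2 := by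
    nlinarith [sq_nonneg (θ - A * p)]
  have h2 : θ / 2 * (Ω * v) ≤ θ ^ 2 / 4 + Ω ^ 2 / 4 * v ^ 2 := by
    nlinarith [sq_nonneg (θ - Ω * v)]
  have h3 : θ / 2 * (Ω * p) ≤ θ ^ 2 / 4 + Ω ^ 2 / 4 * p ^ 2 := by
    nlinarith [sq_nonneg (θ - Ω * p)]
  have h4 : θ / 2 * (Ω * η ^ 2 * v) ≤ Ω * S / (2 * k) * (k * η ^ 2) := by
    have : θ * v ≤ S := (le_abs_self _).trans (by
      rw [abs_mul, abs_of_nonneg hθ0]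
      exact (mul_le_of_le_one_left (abs_nonneg _) hθ1).trans hv)
    calc θ / 2 * (Ω * η ^ 2 * v) = Ω * η ^ 2 / 2 * (θ * v) := by ring
      _ ≤ Ω * η ^ 2 / 2 * S := by gcongr
      _ = _ := by field_simp
  have h5 : θ * (Ω * η * v) ≤ Ω / (2 * s) * (k * η ^ 2 + v ^ 2) := by
    calc θ * (Ω * η * v) ≤ |θ * (Ω * η * v)| := le_abs_self _
      _ = θ * (Ω * (|η| * |v|)) := by
        rw [abs_mul, abs_mul, abs_mul, abs_of_nonneg hθ0, abs_of_nonneg hΩ, mul_assoc]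
      _ ≤ Ω * (|η| * |v|) := mul_le_of_le_one_left (by positivity) hθ1
      _ ≤ Ω * ((k * η ^ 2 + v ^ 2) / (2 * s)) := by gcongr; exact young v
      _ = _ := by ring
  have h6 : θ / 2 * (Ω * (η * (η + 2)) * p) ≤ Ω * (M + 1) / (4 * s) * (k * η ^ 2 + p ^ 2) := by
    calc θ / 2 * (Ω * (η * (η + 2)) * p) ≤ |θ / 2 * (Ω * (η * (η + 2)) * p)| := le_abs_self _
      _ = θ * (Ω / 2 * (|η + 2| * (|η| * |p|))) := by
        rw [abs_mul, abs_mul, abs_mul, abs_mul, abs_of_nonneg (by positivity : 0 ≤ θ / 2),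
          abs_of_nonneg hΩ]
        ring
      _ ≤ Ω / 2 * (|η + 2| * (|η| * |p|)) := mul_le_of_le_one_left (by positivity) hθ1
      _ ≤ Ω / 2 * ((M + 1) * ((k * η ^ 2 + p ^ 2) / (2 * s))) := by gcongr; exact young p
      _ = _ := by ring
  have h7 : 0 ≤ θ / 2 * ((v + p) ^ 2 / 2 + k / 2 * (η + 1) ^ 2) := by positivity
  have h8 : 0 ≤ A ^ 2 / 4 * (v ^ 2 + k * η ^ 2) + Ω ^ 2 / 4 * (k * η ^ 2)
      + Ω * S / (2 * k) * (v ^ 2 + p ^ 2) + Ω / (2 * s) * p ^ 2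
      + Ω * (M + 1) / (4 * s) * v ^ 2 := by positivity
  nlinarith [h1, h2, h3, h4, h5, h6, h7, h8]

namespace R2CHFlow

variable {A Ω T M : ℝ} {u ux uxx uxxx ut utx ρ ρx : ℝ → ℝ → ℝ}

theorem abs_u_le (h : R2CHFlow A Ω T M u ux uxx uxxx ut utx ρ ρx)
    (hΩ : 0 ≤ Ω) (hk : 0 < 1 - 2 * Ω * A) {t : ℝ} (ht : t ∈ Ico 0 T) (x : ℝ) :
    |u t x| ≤ √((∫ y, energyDensity A Ω u ux ρ 0 y) / 2) :=
  abs_le_sqrt (h.energy_eq hΩ hk ht ▸ h.sq_le_half_energy hk ht x)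

theorem slopeForcing_le (h : R2CHFlow A Ω T M u ux uxx uxxx ut utx ρ ρx)
    (hΩ : 0 ≤ Ω) (hk : 0 < 1 - 2 * Ω * A) {E t : ℝ}
    (hE : ∫ y, energyDensity A Ω u ux ρ 0 y = E) (ht : t ∈ Ico 0 T) (x : ℝ) :
    slopeForcing u ux uxx utx t x ≤ E / 4 + (1 - 2 * Ω * A) / 2 * M ^ 2 + Ω * M ^ 2 * √(E / 2)
      + 3 / 4 + nonlocalCoeff A Ω M √(E / 2) * E := by
  obtain ⟨b, htb, hbT⟩ := exists_between ht.2
  obtain ⟨C, hC⟩ := h.exists_abs_le hΩ hk le_rfl (ht.1.trans_lt htb) hbT (K := E)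
    fun s hs => ((h.energy_eq hΩ hk ⟨hs.1, hs.2.trans_lt hbT⟩).trans hE).le
  replace hC := hC t ⟨ht.1, htb.le⟩
  have hu : ∀ y, |u t y| ≤ √(E / 2) := fun y => hE ▸ h.abs_u_le hΩ hk ht y
  have hEt : ∫ y, energyDensity A Ω u ux ρ t y = E := (h.energy_eq hΩ hk ht).trans hE
  have he_int : Integrable (energyDensity A Ω u ux ρ t) := h.integrable_energy t ht
  set S := √(E / 2)
  set c := nonlocalCoeff A Ω M S with hc
  have hS0 : 0 ≤ S := sqrt_nonneg _
  have hM0 : 0 ≤ M := (abs_nonneg _).trans (h.ρ_le t ht x)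
  have hc0 : 0 ≤ c := by unfold nonlocalCoeff at hc; rw [hc]; positivity
  set f : ℝ → ℝ := fun y => u t y ^ 2 / 2 - A * u t y - (1 - 2 * Ω * A) / 2 with hf
  set φ : ℝ → ℝ := fun y =>
    pressureDefect A Ω u ux uxx utx ρ t y + acceleration u ux ut t y + f y with hφ
  set ψ : ℝ → ℝ := fun y =>
    pressureDefect A Ω u ux uxx utx ρ t y - acceleration u ux ut t y + f y with hψ
  have hfd : ∀ y, HasDerivAt f (u t y * ux t y - A * ux t y) y := fun y =>
    (((((h.hasDerivAt_u t ht y).pow 2).div_const 2).sub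
      ((h.hasDerivAt_u t ht y).const_mul A)).sub_const _).congr_deriv (by norm_num; ring)
  have hfC : ∀ y, |f y| ≤ C ^ 2 / 2 + |A| * C + (1 - 2 * Ω * A) / 2 := fun y => by
    have hu := (hC y).1
    refine (abs_sub _ _).trans (add_le_add ((abs_sub _ _).trans (add_le_add ?_ ?_)) ?_)
    · rw [abs_div, abs_pow, abs_two]; gcongr
    · rw [abs_mul]; gcongr
    · rw [abs_of_pos (by positivity)]
  set B := C + (C ^ 2 / 2 + |A| * C + (1 - 2 * Ω * A) / 2) with hB
  have hφB : ∀ y, φ y ≤ B := fun y =>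
    (le_abs_self _).trans ((abs_add_le _ _).trans (add_le_add (hC y).2.1 (hfC y)))
  have hψB : ∀ y, ψ y ≤ B := fun y => by
    have := (abs_le.1 (hC y).2.2).1
    have := (abs_le.1 (hfC y)).2
    simp only [hψ]
    linarith
  have hz := fun y => h.hasDerivAt_pressureDefect ht y
  have hw := fun y => h.hasDerivAt_acceleration ht y
  have hexp : ∀ y, HasDerivAt (fun y => exp (x - y)) (-exp (x - y)) y := fun y =>
    (((hasDerivAt_id y).const_sub x).exp).congr_deriv (by simp)
  have hexp' : ∀ y, HasDerivAt (fun y => exp (y - x)) (exp (y - x)) y := fun y =>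
    (((hasDerivAt_id y).sub_const x).exp).congr_deriv (by simp)
  have hr : ∀ X, x ≤ X → -(exp (x - X) / 2 * φ X) + 3 / 8 * exp (x - X) ^ 2
      - (-(exp (x - x) / 2 * φ x) + 3 / 8 * exp (x - x) ^ 2)
      ≤ ∫ y in x..X, c * energyDensity A Ω u ux ρ t y := by
    intro X hX
    refine sub_le_integral_of_deriv_le hX (fun y => ((((hexp y).div_const 2).mul
      (((hz y).add (hw y)).add (hfd y))).neg.add (((hexp y).pow 2).const_mul (3 / 8))))
      (he_int.const_mul c) fun y hy => ?_
    have := half_mul_nonlocal_le (p := ux t y) hΩ hk (hu y) (h.ρ_le t ht y)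
      (exp_pos (x - y)).le (exp_le_one_iff.2 (by linarith [hy.1]))
    refine le_trans (le_of_eq ?_) (sub_le_iff_le_add'.2 this)
    simp only [hf, pressure, Pi.add_apply]
    norm_num
    ring
  have hl : ∀ X, X ≤ x → exp (x - x) / 2 * ψ x - 3 / 8 * exp (x - x) ^ 2
      - (exp (X - x) / 2 * ψ X - 3 / 8 * exp (X - x) ^ 2)
      ≤ ∫ y in X..x, c * energyDensity A Ω u ux ρ t y := by
    intro X hX
    refine sub_le_integral_of_deriv_le hX (fun y => ((((hexp' y).div_const 2).mul
      (((hz y).sub (hw y)).add (hfd y))).sub (((hexp' y).pow 2).const_mul (3 / 8))))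
      (he_int.const_mul c) fun y hy => ?_
    have := half_mul_nonlocal_le (p := -ux t y) hΩ hk (hu y) (h.ρ_le t ht y)
      (exp_pos (y - x)).le (exp_le_one_iff.2 (by linarith [hy.2]))
    rw [neg_sq] at this
    refine le_trans (le_of_eq ?_) (sub_le_iff_le_add'.2 this)
    simp only [hf, pressure, Pi.add_apply, Pi.sub_apply]
    norm_num
    ring
  have key : ∀ᶠ X in atTop, (φ x + ψ x) / 2 - 3 / 4 - (exp (x - X) / 2 + exp (-X - x) / 2) * B
      ≤ c * E := by
    filter_upwards [eventually_ge_atTop |x|] with X hX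
    have hx := abs_le.1 hX
    have h1 := hr X hx.2
    have h2 := hl (-X) hx.1
    have h3 := intervalIntegral.integral_add_adjacent_intervals
      ((he_int.const_mul c).intervalIntegrable (a := -X) (b := x))
      ((he_int.const_mul c).intervalIntegrable (a := x) (b := X))
    have h4 := intervalIntegral_le_integral (hx.1.trans hx.2) (he_int.const_mul c)
      fun y => mul_nonneg hc0 (energyDensity_nonneg hk t y)
    rw [integral_const_mul, hEt] at h4
    have h5 := mul_le_mul_of_nonneg_left (hφB X) (half_pos (exp_pos (x - X))).le
    have h6 := mul_le_mul_of_nonneg_left (hψB (-X)) (half_pos (exp_pos (-X - x))).le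
    rw [sub_self, exp_zero] at h1 h2
    linarith [sq_nonneg (exp (x - X)), sq_nonneg (exp (-X - x))]
  have hlim : Tendsto (fun X => (φ x + ψ x) / 2 - 3 / 4
      - (exp (x - X) / 2 + exp (-X - x) / 2) * B) atTop (𝓝 ((φ x + ψ x) / 2 - 3 / 4)) := by
    have h1 : Tendsto (fun X => exp (x - X)) atTop (𝓝 0) :=
      tendsto_exp_atBot.comp (tendsto_const_nhds.add_atBot tendsto_neg_atTop_atBot)
    have h2 : Tendsto (fun X => exp (-X - x)) atTop (𝓝 0) :=
      tendsto_exp_atBot.comp (tendsto_neg_atTop_atBot.atBot_add tendsto_const_nhds)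
    simpa using (((h1.div_const 2).add (h2.div_const 2)).mul_const B).const_sub
      ((φ x + ψ x) / 2 - 3 / 4)
  have hmain := le_of_tendsto hlim key
  have hQ : slopeForcing u ux uxx utx t x = (φ x + ψ x) / 2 + u t x ^ 2 / 2
      + (1 - 2 * Ω * A) / 2 * ρ t x ^ 2 - Ω * ρ t x ^ 2 * u t x := by
    simp only [hφ, hψ, hf, slopeForcing, pressureDefect, pressure]
    ring
  have h1 : u t x ^ 2 ≤ E / 2 := hEt ▸ h.sq_le_half_energy hk ht x
  have hρ2 : ρ t x ^ 2 ≤ M ^ 2 := sq_le_sq.2 ((h.ρ_le t ht x).trans (le_abs_self _))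
  have h2 : (1 - 2 * Ω * A) / 2 * ρ t x ^ 2 ≤ (1 - 2 * Ω * A) / 2 * M ^ 2 := by gcongr
  have h3 : -(Ω * ρ t x ^ 2 * u t x) ≤ Ω * M ^ 2 * S := by
    rw [← mul_neg]
    exact (mul_le_mul_of_nonneg_left ((neg_le_abs _).trans (hu x)) (by positivity)).trans
      (by gcongr)
  rw [hQ]
  linarith

end R2CHFlow

theorem three_mul_bound_le_Nconst {A Ω M E : ℝ} (hΩ : 0 ≤ Ω) (hk : 0 < 1 - 2 * Ω * A) (hM : 0 ≤ M)
    (hE : 0 ≤ E) : 3 * (E / 4 + (1 - 2 * Ω * A) / 2 * M ^ 2 + Ω * M ^ 2 * √(E / 2)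
      + 3 / 4 + nonlocalCoeff A Ω M √(E / 2) * E) * E ≤ Nconst A Ω M E := by
  unfold nonlocalCoeff Nconst
  have hA : 1 - Ω * A = (1 + (1 - 2 * Ω * A)) / 2 := by ring
  rw [hA]
  set k := 1 - 2 * Ω * A with hk_def
  clear_value k
  have hS : √(E / 2) = √2 * √E / 2 := by
    rw [sqrt_div hE, eq_div_iff two_ne_zero, div_mul_eq_mul_div, div_eq_iff (by positivity)]
    linear_combination -√E * sq_sqrt (show (0 : ℝ) ≤ 2 by norm_num)
  have h2 : 1 ≤ √2 := one_le_sqrt.2 one_le_two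
  have hs : 0 < √k := sqrt_pos.2 hk
  have hsk : √k ^ 2 = k := sq_sqrt hk.le
  have h1 : 3 * (Ω / (2 * √k)) ≤ 3 * √2 * Ω / (2 * √k) := by
    rw [← mul_div_assoc]
    gcongr
    nlinarith
  have h3 : 3 * (Ω * (M + 1) / (4 * √k)) ≤ 3 * Ω * ((1 + k) / 2) * (M + 1) / (2 * k) := by
    have : 1 / √k ≤ (1 + k) / k := by
      rw [div_le_div_iff₀ hs hk]
      nlinarith [sq_nonneg (√k - 1)]
    calc 3 * (Ω * (M + 1) / (4 * √k)) = 3 * Ω * (M + 1) / 4 * (1 / √k) := by field_simp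
      _ ≤ 3 * Ω * (M + 1) / 4 * ((1 + k) / k) := by gcongr
      _ = _ := by field_simp; ring
  have h4 := mul_le_mul_of_nonneg_right (add_le_add h1 h3) (sq_nonneg E)
  have h5 : 3 * (Ω * √(E / 2) / (2 * k)) * E ^ 2
      = (3 * √2 * Ω / (4 * k)) * (E ^ 2 * √E) := by
    rw [hS]; field_simp; ring
  have h6 : 3 * (Ω * M ^ 2 * √(E / 2)) * E = (3 * √2 * Ω * M ^ 2 / 2) * (E * √E) := by
    rw [hS]; ring
  nlinarith [mul_nonneg (sq_nonneg Ω) (sq_nonneg E), sq_nonneg E]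

section DominatedByDensity

variable {f e : ℝ → ℝ → ℝ} {T C : ℝ}

theorem abs_integral_sub_intervalIntegral_le {f e : ℝ → ℝ} {a b : ℝ} (hab : a ≤ b)
    (hf : Integrable f) (he : Integrable e) (hle : ∀ x, |f x| ≤ e x) :
    |(∫ x, f x) - ∫ x in a..b, f x| ≤ (∫ x, e x) - ∫ x in a..b, e x := by
  have h1 := intervalIntegral_le_integral hab (he.sub hf) fun x =>
    sub_nonneg.2 ((le_abs_self _).trans (hle x))
  have h2 := intervalIntegral_le_integral hab (he.add hf) fun x => by
    simp only [Pi.add_apply]; linarith [(abs_le.1 (hle x)).1]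
  simp only [Pi.sub_apply, Pi.add_apply] at h1 h2
  rw [integral_sub he hf,
    intervalIntegral.integral_sub he.intervalIntegrable hf.intervalIntegrable] at h1
  rw [integral_add he hf,
    intervalIntegral.integral_add he.intervalIntegrable hf.intervalIntegrable] at h2
  exact abs_le.2 ⟨by linarith, by linarith⟩

theorem integrable_of_abs_le_mul {f e : ℝ → ℝ} (hf : Continuous f) (he : Integrable e)
    (hle : ∀ x, |f x| ≤ C * e x) : Integrable f :=
  (he.const_mul C).mono' hf.aestronglyMeasurable (Eventually.of_forall hle)

/-- A jointly continuous density of constant total mass is locally uniformly tight, so that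
functions dominated by it have continuous integrals. -/
theorem continuousOn_integral_of_abs_le_mul {E : ℝ}
    (ce : ContinuousOn (fun p : ℝ × ℝ => e p.1 p.2) (Ico 0 T ×ˢ univ))
    (cf : ContinuousOn (fun p : ℝ × ℝ => f p.1 p.2) (Ico 0 T ×ˢ univ))
    (he_int : ∀ t ∈ Ico 0 T, Integrable (e t)) (hE : ∀ t ∈ Ico 0 T, ∫ x, e t x = E)
    (hle : ∀ b < T, ∃ C, ∀ t ∈ Icc 0 b, ∀ x, |f t x| ≤ C * e t x) :
    ContinuousOn (fun t => ∫ x, f t x) (Ico 0 T) := by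
  refine continuousOn_Ico_of_Icc fun b _ hb => ?_
  have hsub : Icc 0 b ⊆ Ico 0 T := fun s hs => ⟨hs.1, hs.2.trans_lt hb⟩
  obtain ⟨C, hC⟩ := hle b hb
  refine fun t₀ ht₀ =>
    continuousWithinAt_of_locally_uniform_approx_of_continuousWithinAt ht₀ fun U hU => ?_
  obtain ⟨ε, hε, hεU⟩ := Metric.mem_uniformity_dist.1 hU
  have hlim : Tendsto (fun R => C * E - ∫ x in (-R)..R, C * e t₀ x) atTop (𝓝 0) := by
    have := (intervalIntegral_tendsto_integral ((he_int t₀ (hsub ht₀)).const_mul C)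
      tendsto_neg_atTop_atBot tendsto_id).const_sub (C * E)
    rwa [integral_const_mul, hE t₀ (hsub ht₀), sub_self] at this
  obtain ⟨R, hR, hR0⟩ := ((hlim.eventually (gt_mem_nhds hε)).and (eventually_ge_atTop 0)).exists
  have cR := (continuousOn_Ico_integral (F := fun t x => C * e t x) (continuousOn_const.mul ce)
    (-R) R).mono hsub
  have hev : ∀ᶠ t in 𝓝[Icc 0 b] t₀, C * E - ∫ x in (-R)..R, C * e t x < ε :=
    (continuousWithinAt_const.sub (cR t₀ ht₀)).eventually (gt_mem_nhds hR)
  refine ⟨_, hev.and self_mem_nhdsWithin, fun t => ∫ x in (-R)..R, f t x,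
    (continuousOn_Ico_integral cf (-R) R).mono hsub t₀ ht₀, fun t ht => hεU ?_⟩
  have ht' := hsub ht.2
  have key := abs_integral_sub_intervalIntegral_le (neg_le_self hR0)
    (integrable_of_abs_le_mul (continuous_slice cf ht') (he_int t ht') (hC t ht.2))
    ((he_int t ht').const_mul C) (hC t ht.2)
  rw [integral_const_mul, hE t ht'] at key
  exact key.trans_lt ht.1

theorem tendsto_integral_integral_of_abs_le_mul {E b : ℝ} (hb0 : 0 ≤ b) (hb : b < T)
    (cf : ContinuousOn (fun p : ℝ × ℝ => f p.1 p.2) (Ico 0 T ×ˢ univ))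
    (he_int : ∀ t ∈ Ico 0 T, Integrable (e t)) (hE : ∀ t ∈ Ico 0 T, ∫ x, e t x = E)
    (hle : ∀ t ∈ Icc 0 b, ∀ x, |f t x| ≤ C * e t x) :
    Tendsto (fun R => ∫ t in (0 : ℝ)..b, ∫ x in (-R)..R, f t x) atTop
      (𝓝 (∫ t in (0 : ℝ)..b, ∫ x, f t x)) := by
  have hsub : uIoc 0 b ⊆ Icc 0 b := by
    rw [uIoc_of_le hb0]; exact Ioc_subset_Icc_self
  have hsubT : Icc 0 b ⊆ Ico 0 T := fun s hs => ⟨hs.1, hs.2.trans_lt hb⟩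
  refine intervalIntegral.tendsto_integral_filter_of_dominated_convergence (fun _ => C * E) ?_ ?_
    intervalIntegrable_const ?_
  · refine Eventually.of_forall fun R => ?_
    rw [uIoc_of_le hb0]
    exact (((continuousOn_Ico_integral cf (-R) R).mono hsubT).mono
      Ioc_subset_Icc_self).aestronglyMeasurable measurableSet_Ioc
  · filter_upwards [eventually_ge_atTop 0] with R hR
    refine Eventually.of_forall fun t ht => ?_
    have ht := hsub ht
    have hi := (he_int t (hsubT ht)).const_mul C
    rw [← hE t (hsubT ht), ← integral_const_mul]
    exact (intervalIntegral.norm_integral_le_of_norm_le (neg_le_self hR)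
      (Eventually.of_forall fun x _ => hle t ht x) hi.intervalIntegrable).trans
      (intervalIntegral_le_integral (neg_le_self hR) hi
        fun x => (abs_nonneg _).trans (hle t ht x))
  · refine Eventually.of_forall fun t ht => ?_
    have ht := hsub ht
    exact intervalIntegral_tendsto_integral
      (integrable_of_abs_le_mul (continuous_slice cf (hsubT ht)) (he_int t (hsubT ht)) (hle t ht))
      tendsto_neg_atTop_atBot tendsto_id

end DominatedByDensity

/-- The density of the time derivative of `∫ (∂ₓu)³ dx`, up to exact spatial derivatives. -/
noncomputable def cubicRate (u ux uxx utx : ℝ → ℝ → ℝ) (t x : ℝ) : ℝ :=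
  -(1 / 2) * ux t x ^ 4 + 3 * ux t x ^ 2 * slopeForcing u ux uxx utx t x

namespace R2CHFlow

variable {A Ω T M : ℝ} {u ux uxx uxxx ut utx ρ ρx : ℝ → ℝ → ℝ} {b C E : ℝ}

theorem exists_bound (h : R2CHFlow A Ω T M u ux uxx uxxx ut utx ρ ρx)
    (hΩ : 0 ≤ Ω) (hk : 0 < 1 - 2 * Ω * A) (hT : 0 < T) (hb : b < T) :
    ∃ C, ∀ t ∈ Icc 0 b, ∀ x,
      |u t x| ≤ C ∧ |slopeForcing u ux uxx utx t x| ≤ C ∧ |ux t x| ≤ C := by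
  obtain ⟨b', hb', hbT⟩ := exists_between (max_lt hT hb)
  obtain ⟨C, hC⟩ := h.exists_abs_slopeForcing_le hΩ hk le_rfl ((le_max_left _ _).trans_lt hb') hbT
    fun s hs => (h.energy_eq hΩ hk ⟨hs.1, hs.2.trans_lt hbT⟩).le
  obtain ⟨m, hm⟩ := h.exists_abs_ux_le le_rfl hbT hC
  refine ⟨max C m, fun t ht x => ?_⟩
  have ht' : t ∈ Icc 0 b' := ⟨ht.1, ht.2.trans ((le_max_right _ _).trans hb'.le)⟩
  exact ⟨(hC t ht' x).1.trans (le_max_left _ _), (hC t ht' x).2.trans (le_max_left _ _),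
    (hm t ht' x).trans (le_max_right _ _)⟩

theorem sq_le_energyDensity (hk : 0 < 1 - 2 * Ω * A) (t x : ℝ) :
    ux t x ^ 2 ≤ energyDensity A Ω u ux ρ t x := by
  unfold energyDensity
  have : 0 ≤ (1 - 2 * Ω * A) * (ρ t x - 1) ^ 2 := by positivity
  linarith [sq_nonneg (u t x)]

theorem abs_mul_sq_le (hk : 0 < 1 - 2 * Ω * A) {B y t x : ℝ} (hy : |y| ≤ B) :
    |y * ux t x ^ 2| ≤ B * energyDensity A Ω u ux ρ t x := by
  rw [abs_mul, abs_of_nonneg (sq_nonneg (ux t x))]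
  exact mul_le_mul hy (sq_le_energyDensity hk t x) (sq_nonneg _) ((abs_nonneg _).trans hy)

theorem continuousOn_cubicRate (h : R2CHFlow A Ω T M u ux uxx uxxx ut utx ρ ρx) :
    ContinuousOn (fun p : ℝ × ℝ => cubicRate u ux uxx utx p.1 p.2) (Ico 0 T ×ˢ univ) := by
  have := h.cont_ux
  have := h.continuousOn_slopeForcing
  unfold cubicRate
  fun_prop

theorem abs_cubicRate_le (hk : 0 < 1 - 2 * Ω * A) {t x : ℝ}
    (hQ : |slopeForcing u ux uxx utx t x| ≤ C) (hux : |ux t x| ≤ C) :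
    |cubicRate u ux uxx utx t x| ≤ (C ^ 2 / 2 + 3 * C) * energyDensity A Ω u ux ρ t x := by
  have e : cubicRate u ux uxx utx t x
      = (-(ux t x ^ 2 / 2) + 3 * slopeForcing u ux uxx utx t x) * ux t x ^ 2 := by
    unfold cubicRate; ring
  rw [e]
  refine abs_mul_sq_le hk ((abs_add_le _ _).trans (add_le_add ?_ ?_))
  · rw [abs_neg, abs_div, abs_pow, abs_two]; gcongr
  · rw [abs_mul, abs_of_pos three_pos]; gcongr

theorem integral_cube_sub_eq (h : R2CHFlow A Ω T M u ux uxx uxxx ut utx ρ ρx)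
    (hΩ : 0 ≤ Ω) (hk : 0 < 1 - 2 * Ω * A) {t : ℝ} (ht : t ∈ Ico 0 T) :
    (∫ x, ux t x ^ 3) - ∫ x, ux 0 x ^ 3
      = ∫ s in (0 : ℝ)..t, ∫ x, cubicRate u ux uxx utx s x := by
  have hsub : Icc 0 t ⊆ Ico 0 T := fun s hs => ⟨hs.1, hs.2.trans_lt ht.2⟩
  obtain ⟨C, hC⟩ := h.exists_bound hΩ hk (ht.1.trans_lt ht.2) ht.2
  have cu := h.cont_u
  have cux := h.cont_ux
  have cuxx := h.cont_uxx
  have cutx := h.cont_utx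
  have cJ : ContinuousOn (fun p : ℝ × ℝ => u p.1 p.2 * ux p.1 p.2 ^ 3) (Ico 0 T ×ˢ univ) := by
    fun_prop
  have cJx : ContinuousOn (fun p : ℝ × ℝ => ux p.1 p.2 ^ 4
      + 3 * u p.1 p.2 * ux p.1 p.2 ^ 2 * uxx p.1 p.2) (Ico 0 T ×ˢ univ) := by
    fun_prop
  have key : ∀ R, (∫ x in (-R)..R, ux t x ^ 3) - ∫ x in (-R)..R, ux 0 x ^ 3
      = (∫ s in (0 : ℝ)..t, ∫ x in (-R)..R, cubicRate u ux uxx utx s x)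
        - ∫ s in (0 : ℝ)..t, (u s R * ux s R ^ 3 - u s (-R) * ux s (-R) ^ 3) := by
    intro R
    rw [integral_sub_integral_eq (F := fun t x => ux t x ^ 3)
      (F' := fun t x => 3 * ux t x ^ 2 * utx t x) le_rfl ht.1 ht.2 (by fun_prop) (by fun_prop)
      (fun x s hs => ((h.time_ux x s hs).pow 3).congr_deriv (by norm_num)),
      ← intervalIntegral.integral_sub]
    · refine intervalIntegral.integral_congr fun s hs => ?_
      rw [uIcc_of_le ht.1] at hs
      replace hs := hsub hs
      have h1 : ∫ x in (-R)..R, (ux s x ^ 4 + 3 * u s x * ux s x ^ 2 * uxx s x)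
          = u s R * ux s R ^ 3 - u s (-R) * ux s (-R) ^ 3 :=
        intervalIntegral.integral_eq_sub_of_hasDerivAt (f := fun x => u s x * ux s x ^ 3)
          (fun x _ => ((h.hasDerivAt_u s hs x).mul ((h.hasDerivAt_ux s hs x).pow 3)).congr_deriv
            (by simp only [Pi.pow_apply]; norm_num; ring))
          ((continuous_slice (F := fun t x => ux t x ^ 4 + 3 * u t x * ux t x ^ 2 * uxx t x)
            cJx hs).intervalIntegrable _ _)
      rw [← h1, ← intervalIntegral.integral_sub
        ((continuous_slice h.continuousOn_cubicRate hs).intervalIntegrable _ _)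
        ((continuous_slice (F := fun t x => ux t x ^ 4 + 3 * u t x * ux t x ^ 2 * uxx t x)
            cJx hs).intervalIntegrable _ _)]
      refine intervalIntegral.integral_congr fun x _ => ?_
      simp only [cubicRate, slopeForcing]
      ring
    · exact ((continuousOn_Ico_integral h.continuousOn_cubicRate _ _).mono
        hsub).intervalIntegrable_of_Icc ht.1
    · exact (((continuousOn_slice (F := fun s x => u s x * ux s x ^ 3) cJ R).sub
        (continuousOn_slice (F := fun s x => u s x * ux s x ^ 3) cJ (-R))).mono
        hsub).intervalIntegrable_of_Icc ht.1
  have hV : ∀ s ∈ Icc 0 t, Tendsto (fun R => ∫ x in (-R)..R, ux s x ^ 3) atTop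
      (𝓝 (∫ x, ux s x ^ 3)) := fun s hs =>
    intervalIntegral_tendsto_integral (integrable_of_abs_le_mul
      ((continuous_slice cux (hsub hs)).pow 3) (h.integrable_energy s (hsub hs)) fun x => by
        rw [pow_succ']
        exact abs_mul_sq_le hk (hC s hs x).2.2) tendsto_neg_atTop_atBot tendsto_id
  have h1 := (hV t (right_mem_Icc.2 ht.1)).sub (hV 0 (left_mem_Icc.2 ht.1))
  simp only [key] at h1
  have h2 := (tendsto_integral_integral_of_abs_le_mul ht.1 ht.2 h.continuousOn_cubicRate
    (e := energyDensity A Ω u ux ρ) h.integrable_energy (fun s hs => h.energy_eq hΩ hk hs)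
    fun s hs x => abs_cubicRate_le hk (hC s hs x).2.1 (hC s hs x).2.2).sub
    (h.tendsto_integral_of_abs_le_mul (J := fun t x => u t x * ux t x ^ 3) (B := C ^ 3)
      le_rfl ht.1 ht.2 cJ
      (fun s hs x => (hC s hs x).1) fun s hs x => by
        rw [abs_mul, abs_pow, mul_comm]
        have := (hC s hs x).2.2
        gcongr)
  rw [sub_zero] at h2
  exact tendsto_nhds_unique h1 h2

theorem hasDerivWithinAt_integral_cube (h : R2CHFlow A Ω T M u ux uxx uxxx ut utx ρ ρx)
    (hΩ : 0 ≤ Ω) (hk : 0 < 1 - 2 * Ω * A) {t : ℝ} (ht : t ∈ Ico 0 T) :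
    HasDerivWithinAt (fun s => ∫ x, ux s x ^ 3) (∫ x, cubicRate u ux uxx utx t x) (Ico 0 T) t := by
  refine hasDerivWithinAt_Ico_of_integral (D := fun t => ∫ x, cubicRate u ux uxx utx t x) ?_
    (fun s hs => h.integral_cube_sub_eq hΩ hk hs) ht
  refine continuousOn_integral_of_abs_le_mul h.continuousOn_energyDensity h.continuousOn_cubicRate
    h.integrable_energy (fun s hs => h.energy_eq hΩ hk hs) fun b hb => ?_
  obtain ⟨C, hC⟩ := h.exists_bound hΩ hk (ht.1.trans_lt ht.2) hb
  exact ⟨_, fun s hs x => abs_cubicRate_le hk (hC s hs x).2.1 (hC s hs x).2.2⟩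

theorem integral_cubicRate_le (h : R2CHFlow A Ω T M u ux uxx uxxx ut utx ρ ρx)
    (hΩ : 0 ≤ Ω) (hk : 0 < 1 - 2 * Ω * A) (hM : 0 ≤ M) {t : ℝ} (ht : t ∈ Ico 0 T) :
    ∫ x, cubicRate u ux uxx utx t x ≤ -(1 / 2) * (∫ x, ux t x ^ 4)
      + Nconst A Ω M (∫ x, energyDensity A Ω u ux ρ 0 x) := by
  have he_int : Integrable (energyDensity A Ω u ux ρ t) := h.integrable_energy t ht
  have hEt := h.energy_eq hΩ hk ht
  set E := ∫ x, energyDensity A Ω u ux ρ 0 x with hE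
  have hE0 : 0 ≤ E := integral_nonneg fun x => energyDensity_nonneg hk 0 x
  obtain ⟨C, hC⟩ := h.exists_bound hΩ hk (ht.1.trans_lt ht.2) ht.2
  replace hC := hC t (right_mem_Icc.2 ht.1)
  have hN := three_mul_bound_le_Nconst hΩ hk hM hE0
  have hq := fun x => h.slopeForcing_le hΩ hk hE.symm ht x
  set q := E / 4 + (1 - 2 * Ω * A) / 2 * M ^ 2 + Ω * M ^ 2 * √(E / 2) + 3 / 4
    + nonlocalCoeff A Ω M √(E / 2) * E with hq_def
  have hq0 : 0 ≤ q := by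
    unfold nonlocalCoeff at hq_def; rw [hq_def]; positivity
  have h4 : Integrable fun x => ux t x ^ 4 :=
    integrable_of_abs_le_mul (C := C ^ 2) ((continuous_slice h.cont_ux ht).pow 4) he_int fun x => by
      rw [show ux t x ^ 4 = ux t x ^ 2 * ux t x ^ 2 by ring]
      refine abs_mul_sq_le hk ?_
      rw [abs_pow]
      have := (hC x).2.2
      gcongr
  have hg : Integrable (cubicRate u ux uxx utx t) :=
    integrable_of_abs_le_mul (continuous_slice h.continuousOn_cubicRate ht) he_int
      fun x => abs_cubicRate_le hk (hC x).2.1 (hC x).2.2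
  calc ∫ x, cubicRate u ux uxx utx t x
      ≤ ∫ x, (-(1 / 2) * ux t x ^ 4 + 3 * q * energyDensity A Ω u ux ρ t x) := by
        refine integral_mono hg ((h4.const_mul _).add (he_int.const_mul _)) fun x => ?_
        have h1 := mul_le_mul_of_nonneg_left (hq x) (sq_nonneg (ux t x))
        have h2 := mul_le_mul_of_nonneg_left
          (sq_le_energyDensity (u := u) (ux := ux) (ρ := ρ) hk t x) hq0
        simp only [cubicRate]
        linarith
    _ = -(1 / 2) * (∫ x, ux t x ^ 4) + 3 * q * E := by
        rw [integral_add (h4.const_mul _) (he_int.const_mul _), integral_const_mul,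
          integral_const_mul, hEt]
    _ ≤ _ := by gcongr

end R2CHFlow

/-- The key differential inequality in the proof of Theorem 4.2: for `σ = 1`, `μ = 0`,
and `‖ρ(t,·)‖_{L^∞} ≤ M̄`, the function `t ↦ ∫ (∂ₓu)³ dx` is differentiable with
`d/dt ∫ (∂ₓu)³ dx ≤ -(1/2) ∫ (∂ₓu)⁴ dx + N`. -/
theorem key_differential_inequality {A Ω T M : ℝ} {u ρ : ℝ → ℝ → ℝ}
    (hΩ : 0 ≤ Ω) (hΩA : 0 < 1 - 2 * Ω * A)
    (hsol : R2CHSolution A 0 1 Ω T u ρ)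
    (hM : 0 ≤ M) (hρM : ∀ t ∈ Ico (0:ℝ) T, ∀ x : ℝ, |ρ t x| ≤ M) :
    ∀ t ∈ Ico (0:ℝ) T,
      DifferentiableWithinAt ℝ (fun s => ∫ x : ℝ, (deriv (u s) x) ^ 3) (Ico 0 T) t ∧
      derivWithin (fun s => ∫ x : ℝ, (deriv (u s) x) ^ 3) (Ico 0 T) t ≤
        -(1 / 2) * (∫ x : ℝ, (deriv (u t) x) ^ 4) + Nconst A Ω M (energy Ω A u ρ 0) := by
  intro t ht
  obtain ⟨ut, utx, h⟩ := hsol.exists_flow hρM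
  have hd := h.hasDerivWithinAt_integral_cube hΩ hΩA ht
  refine ⟨hd.differentiableWithinAt, ?_⟩
  rw [hd.derivWithin (uniqueDiffOn_Ico 0 T t ht)]
  exact h.integral_cubicRate_le hΩ hΩA hM ht
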